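/- arXiv:1307.5078 — 4 statements merged into one kernel-verified Lean document; each statement's English description precedes it below -/
import Mathlib

section
/- If n ≥ 2, m ≥ 2, and k ≥ 2 are integers with 5^n - 4^n = m^k, then n = 2 (so that 5^2 - 4^2 = 9 = 3^2). In other words, 9 is the only perfect power of the form 5^n - 4^n with n ≥ 2. -/
theorem square_case {n y : ℕ} (hn : 2 ≤ n) (h : y ^ 2 + 4 ^ n = 5 ^ n) : n = 2 := by
  rcases Nat.even_or_odd' n with ⟨t, rfl | rfl⟩
  · have ht : 1 ≤ t := by omega
    have hlt : y < 5 ^ t := by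
      have h4 : 0 < 4 ^ (2 * t) := by positivity
      have : y ^ 2 < (5 ^ t) ^ 2 := by rw [← pow_mul, mul_comm t 2]; omega
      exact lt_of_pow_lt_pow_left₀ 2 (by positivity) this
    obtain ⟨d, hd⟩ := Nat.exists_eq_add_of_lt hlt
    have hprod : (d + 1) * (5 ^ t + y) = 2 ^ (4 * t) := by
      have e1 : (5 : ℕ) ^ (2 * t) = (5 ^ t) ^ 2 := by rw [← pow_mul, mul_comm]
      have e2 : (4 : ℕ) ^ (2 * t) = 2 ^ (4 * t) := by
        rw [show (4 : ℕ) = 2 ^ 2 by norm_num, ← pow_mul]; congr 1; ring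
      rw [e1, e2, hd] at h
      rw [hd]; nlinarith
    obtain ⟨a, -, ha⟩ := (Nat.dvd_prime_pow Nat.prime_two).1 (Dvd.intro _ hprod)
    obtain ⟨b, -, hb⟩ := (Nat.dvd_prime_pow Nat.prime_two).1 (Dvd.intro_left _ hprod)
    have hsum : 2 ^ a + 2 ^ b = 2 * 5 ^ t := by omega
    have hab : a + b = 4 * t := by
      rw [ha, hb, ← pow_add] at hprod
      exact Nat.pow_right_injective le_rfl hprod
    have h5 : 5 ^ t % 2 = 1 := by rw [Nat.pow_mod]; norm_num
    have h5' : 5 ≤ 5 ^ t := by simpa using Nat.pow_le_pow_right (n := 5) (by norm_num) ht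
    have hle : a ≤ b := by
      apply (Nat.pow_le_pow_iff_right (a := 2) (by norm_num)).1
      omega
    have ha1 : a = 1 := by
      rcases a with _ | _ | a
      · exfalso
        rcases b with _ | b
        · omega
        · rw [pow_succ] at hsum; omega
      · rfl
      · exfalso
        obtain ⟨c, rfl⟩ : ∃ c, b = c + 2 := ⟨b - 2, by omega⟩
        rw [pow_add, pow_add, pow_add 2 c 2] at hsum
        omega
    subst ha1
    have hb' : b = 4 * (t - 1) + 3 := by omega
    obtain ⟨s, rfl⟩ : ∃ s, t = s + 1 := ⟨t - 1, by omega⟩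
    rcases s with _ | s
    · rfl
    · exfalso
      have e : (2 : ℕ) ^ b = 128 * 16 ^ s := by
        rw [hb', show (16 : ℕ) = 2 ^ 4 by norm_num, ← pow_mul, show (128 : ℕ) = 2 ^ 7 by norm_num,
          ← pow_add]; congr 1; omega
      have : (5 : ℕ) ^ s ≤ 16 ^ s := Nat.pow_le_pow_left (by norm_num) s
      rw [e, pow_add, pow_add] at hsum
      have : 1 ≤ 16 ^ s := Nat.one_le_pow _ _ (by norm_num)
      omega
  · exfalso
    have ht : 1 ≤ t := by omega
    obtain ⟨s, rfl⟩ : ∃ s, t = s + 1 := ⟨t - 1, by omega⟩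
    have h' : (y ^ 2 + 4 ^ (2 * (s + 1) + 1)) % 8 = 5 ^ (2 * (s + 1) + 1) % 8 := by rw [h]
    have e1 : 5 ^ (2 * (s + 1) + 1) % 8 = 5 := by
      rw [pow_succ, pow_mul, Nat.mul_mod, Nat.pow_mod]; norm_num
    have e2 : 4 ^ (2 * (s + 1) + 1) % 8 = 0 := by
      rw [show 2 * (s + 1) + 1 = 2 * s + 1 + 2 by ring, pow_add]; omega
    have : y % 8 < 8 := Nat.mod_lt _ (by norm_num)
    rw [Nat.add_mod, e1, e2, Nat.pow_mod] at h'
    interval_cases y % 8 <;> omega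

theorem odd_exponent_of_descent {p : ℕ} (hp : p.Prime) (hp2 : p ≠ 2)
    (hodd : ∀ n y : ℕ, Odd n → 3 ≤ n → y ^ p + 4 ^ n ≠ 5 ^ n) :
    ∀ n y : ℕ, 2 ≤ n → y ^ p + 4 ^ n ≠ 5 ^ n := by
  intro n
  induction n using Nat.strong_induction_on with
  | _ n ih =>
    intro y hn h
    rcases Nat.even_or_odd' n with ⟨t, rfl | rfl⟩
    · have hlt : 4 ^ t < 5 ^ t := Nat.pow_lt_pow_left (by norm_num) (by omega)
      have hprod : (5 ^ t - 4 ^ t) * (5 ^ t + 4 ^ t) = y ^ p := by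
        obtain ⟨d, hd⟩ := Nat.exists_eq_add_of_lt hlt
        rw [mul_comm 2 t, pow_mul, pow_mul] at h
        rw [hd] at h ⊢
        have : 4 ^ t + d + 1 - 4 ^ t = d + 1 := by omega
        rw [this]; nlinarith
      have hcop : Nat.Coprime (5 ^ t - 4 ^ t) (5 ^ t + 4 ^ t) := by
        apply Nat.Coprime.symm
        rw [Nat.coprime_iff_gcd_eq_one]
        by_contra hg
        obtain ⟨q, hq, hqd⟩ := Nat.exists_prime_and_dvd hg
        have h1 := hqd.trans (Nat.gcd_dvd_left _ _)
        have h2 := hqd.trans (Nat.gcd_dvd_right _ _)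
        have h3 : q ∣ 2 * 5 ^ t := by
          have := dvd_add h1 h2
          rwa [show 5 ^ t + 4 ^ t + (5 ^ t - 4 ^ t) = 2 * 5 ^ t by omega] at this
        have h4 : q ∣ 2 * 4 ^ t := by
          have := Nat.dvd_sub h1 h2
          rwa [show 5 ^ t + 4 ^ t - (5 ^ t - 4 ^ t) = 2 * 4 ^ t by omega] at this
        have hodd5 : 5 ^ t % 2 = 1 := by rw [Nat.pow_mod]; norm_num
        have heven4 : 4 ^ t % 2 = 0 := by
          rw [Nat.pow_mod, show 4 % 2 = 0 by norm_num, zero_pow (by omega), Nat.zero_mod]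
        have hq2 : q ≠ 2 := by rintro rfl; omega
        have a1 : q ∣ 5 := by
          rcases (Nat.Prime.dvd_mul hq).1 h3 with h | h
          · exact absurd ((Nat.prime_dvd_prime_iff_eq hq Nat.prime_two).1 h) hq2
          · exact hq.dvd_of_dvd_pow h
        have a2 : q ∣ 4 := by
          rcases (Nat.Prime.dvd_mul hq).1 h4 with h | h
          · exact absurd ((Nat.prime_dvd_prime_iff_eq hq Nat.prime_two).1 h) hq2
          · exact hq.dvd_of_dvd_pow h
        have := Nat.dvd_sub a1 a2
        exact hq.one_lt.ne' (Nat.dvd_one.1 this)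
      obtain ⟨a, ha⟩ := exists_eq_pow_of_mul_eq_pow (Nat.isUnit_iff.2 hcop) hprod
      rcases Nat.lt_or_ge t 2 with ht | ht
      · obtain rfl : t = 1 := by omega
        norm_num at h
        have hy : y ^ p = 9 := by omega
        have h3 : 3 ≤ p := by have := hp.two_le; omega
        have hy3 : y < 3 := by
          by_contra hc
          have : 3 ^ 3 ≤ y ^ p := (Nat.pow_le_pow_left (by omega) 3).trans
            (Nat.pow_le_pow_right (by omega) h3)
          omega
        have hp0 : p ≠ 0 := hp.ne_zero
        interval_cases y
        · simp [hp0] at hy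
        · simp at hy
        · obtain ⟨k, rfl⟩ : ∃ k, p = k + 1 := ⟨p - 1, by omega⟩
          rw [pow_succ] at hy; omega
      · exact ih t (by omega) a ht (by omega)
    · exact hodd _ y ⟨t, rfl⟩ (by omega) h

theorem not_dvd_exponent {p n y : ℕ} (hp : p.Prime) (hp2 : p ≠ 2) (hn : 3 ≤ n)
    (h : y ^ p + 4 ^ n = 5 ^ n) : ¬ p ∣ n := by
  rintro ⟨t, rfl⟩
  have hp1 : 1 < p := hp.one_lt
  have hoddp : Odd p := hp.odd_of_ne_two hp2
  rw [mul_comm p t, pow_mul 5, ] at h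
  have hlt : y < 5 ^ t := by
    have h4 : 0 < 4 ^ (t * p) := by positivity
    exact lt_of_pow_lt_pow_left₀ p (by positivity) (show y ^ p < (5 ^ t) ^ p by omega)
  have hyodd : y % 2 = 1 := by
    have e5 : (5 ^ t) ^ p % 2 = 1 := by rw [← pow_mul, Nat.pow_mod]; norm_num
    have e4 : 4 ^ (t * p) % 2 = 0 := by
      rw [Nat.pow_mod, show 4 % 2 = 0 by norm_num, zero_pow (by rw [mul_comm]; omega), Nat.zero_mod]
    by_contra hc
    have : y ^ p % 2 = 0 := by
      rw [Nat.pow_mod, show y % 2 = 0 by omega, zero_pow hp.ne_zero, Nat.zero_mod]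
    omega
  have hgeom : ((∑ i ∈ Finset.range p, (5 ^ t) ^ i * y ^ (p - 1 - i) : ℕ) : ℤ) *
      (((5 ^ t : ℕ) : ℤ) - y) = 2 ^ (2 * (t * p)) := by
    have := (Commute.all ((5 ^ t : ℕ) : ℤ) (y : ℤ)).geom_sum₂_mul p
    rw [pow_mul 2 2]
    push_cast at this ⊢
    rw [this]
    have h' : ((y : ℤ) ^ p + 4 ^ (t * p) = (5 ^ t) ^ p) := by exact_mod_cast h
    linarith
  set F := ∑ i ∈ Finset.range p, (5 ^ t) ^ i * y ^ (p - 1 - i) with hF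
  have hdvd : F ∣ 2 ^ (2 * (t * p)) := by
    have : (F : ℤ) ∣ ((2 ^ (2 * (t * p)) : ℕ) : ℤ) := ⟨_, by push_cast; rw [hgeom]⟩
    exact Int.natCast_dvd_natCast.1 this
  have hFodd : F % 2 = 1 := by
    rw [hF, Finset.sum_nat_mod]
    have : ∀ i ∈ Finset.range p, (5 ^ t) ^ i * y ^ (p - 1 - i) % 2 = 1 := by
      intro i _
      rw [Nat.mul_mod, Nat.pow_mod, Nat.pow_mod 5, Nat.pow_mod y, hyodd]; norm_num
    rw [Finset.sum_congr rfl this]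
    simp only [Finset.sum_const, Finset.card_range, smul_eq_mul, mul_one]
    exact Nat.odd_iff.1 hoddp
  obtain ⟨a, -, ha⟩ := (Nat.dvd_prime_pow Nat.prime_two).1 hdvd
  have ha0 : a = 0 := by
    rcases a with _ | a
    · rfl
    · rw [ha, pow_succ] at hFodd; omega
  have hF1 : F = 1 := by rw [ha, ha0, pow_zero]
  have hpF : p ≤ F := by
    rw [hF]
    calc p = ∑ i ∈ Finset.range p, 1 := by simp
      _ ≤ _ := Finset.sum_le_sum fun i _ => Nat.one_le_iff_ne_zero.2 (by
        have : y ≠ 0 := by rintro rfl; omega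
        positivity)
  omega

theorem root_residues {p n y : ℕ} (hp : Odd p) (hn : Odd n) (hn3 : 3 ≤ n)
    (h : y ^ p + 4 ^ n = 5 ^ n) : y % 8 = 5 ∧ y % 5 = 1 ∧ y % 3 = 1 := by
  obtain ⟨b, rfl⟩ := hn
  have hp0 : p ≠ 0 := hp.pos.ne'
  have hp8 : p * p % 8 = 1 := by
    obtain ⟨a, rfl⟩ := hp
    rcases Nat.even_or_odd' a with ⟨c, rfl | rfl⟩ <;> ring_nf <;> omega
  have hpp : ∃ c, p * p = 8 * c + 1 := ⟨p * p / 8, by omega⟩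
  obtain ⟨c, hc⟩ := hpp
  refine ⟨?_, ?_, ?_⟩
  · have e2 : 4 ^ (2 * b + 1) % 8 = 0 := by
      obtain ⟨c, rfl⟩ : ∃ c, b = c + 1 := ⟨b - 1, by omega⟩
      rw [show 2 * (c + 1) + 1 = 2 * c + 1 + 2 by ring, pow_add]; omega
    have e1 : 5 ^ (2 * b + 1) % 8 = 5 := by
      rw [pow_succ, pow_mul, Nat.mul_mod, Nat.pow_mod]; norm_num
    have e3 : y ^ p % 8 = 5 := by
      generalize 4 ^ (2 * b + 1) = u at *
      generalize 5 ^ (2 * b + 1) = v at *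
      omega
    have e4 : (y ^ p) ^ p % 8 = 5 := by
      obtain ⟨a, rfl⟩ := hp
      rw [Nat.pow_mod, e3, pow_succ, pow_mul, Nat.mul_mod, Nat.pow_mod]; norm_num
    have hy : y % 2 = 1 := by
      by_contra hy
      have : y ^ p % 2 = 0 := by
        rw [Nat.pow_mod, show y % 2 = 0 by omega, zero_pow hp0, Nat.zero_mod]
      omega
    have e5 : y ^ 8 % 8 = 1 := by
      have : y % 8 = 1 ∨ y % 8 = 3 ∨ y % 8 = 5 ∨ y % 8 = 7 := by omega
      rw [Nat.pow_mod]
      rcases this with h | h | h | h <;> rw [h]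
    rw [← pow_mul, hc, pow_succ, pow_mul, Nat.mul_mod, Nat.pow_mod (y ^ 8), e5] at e4
    norm_num at e4
    exact e4
  · have e2 : 4 ^ (2 * b + 1) % 5 = 4 := by
      rw [pow_succ, pow_mul, Nat.mul_mod, Nat.pow_mod]; norm_num
    have e1 : 5 ^ (2 * b + 1) % 5 = 0 := by rw [pow_succ]; omega
    have e3 : y ^ p % 5 = 1 := by
      generalize 4 ^ (2 * b + 1) = u at *
      generalize 5 ^ (2 * b + 1) = v at *
      omega
    have e4 : (y ^ p) ^ p % 5 = 1 := by rw [Nat.pow_mod, e3, one_pow]; norm_num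
    have hy : y % 5 ≠ 0 := by
      intro hy
      rw [Nat.pow_mod, hy, zero_pow hp0] at e3
      omega
    have e5 : y ^ 8 % 5 = 1 := by
      have : y % 5 = 1 ∨ y % 5 = 2 ∨ y % 5 = 3 ∨ y % 5 = 4 := by omega
      rw [Nat.pow_mod]
      rcases this with h | h | h | h <;> rw [h]
    rw [← pow_mul, hc, pow_succ, pow_mul, Nat.mul_mod, Nat.pow_mod (y ^ 8), e5] at e4
    norm_num at e4
    exact e4
  · have e2 : 4 ^ (2 * b + 1) % 3 = 1 := by
      rw [Nat.pow_mod]; norm_num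
    have e1 : 5 ^ (2 * b + 1) % 3 = 2 := by
      rw [pow_succ, pow_mul, Nat.mul_mod, Nat.pow_mod]; norm_num
    have e3 : y ^ p % 3 = 1 := by
      generalize 4 ^ (2 * b + 1) = u at *
      generalize 5 ^ (2 * b + 1) = v at *
      omega
    have e4 : (y ^ p) ^ p % 3 = 1 := by rw [Nat.pow_mod, e3, one_pow]; norm_num
    have hy : y % 3 ≠ 0 := by
      intro hy
      rw [Nat.pow_mod, hy, zero_pow hp0] at e3
      omega
    have e5 : y ^ 8 % 3 = 1 := by
      have : y % 3 = 1 ∨ y % 3 = 2 := by omega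
      rw [Nat.pow_mod]
      rcases this with h | h <;> rw [h]
    rw [← pow_mul, hc, pow_succ, pow_mul, Nat.mul_mod, Nat.pow_mod (y ^ 8), e5] at e4
    norm_num at e4
    exact e4

theorem exponent_ratio {p n y : ℕ} (hp : Odd p) (hn : Odd n) (hn3 : 3 ≤ n)
    (h : y ^ p + 4 ^ n = 5 ^ n) : 51 * p < 20 * n := by
  obtain ⟨h8, h5, h3⟩ := root_residues hp hn hn3 h
  have hy : 61 ≤ y := by omega
  have h1 : 61 ^ p < 5 ^ n := by
    have := Nat.pow_le_pow_left hy p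
    have h4 : 0 < 4 ^ n := by positivity
    omega
  by_contra hc
  have h2 : (5 ^ n) ^ 20 ≤ (61 ^ p) ^ 20 := by
    rw [← pow_mul, ← pow_mul, mul_comm p 20, pow_mul 61]
    calc 5 ^ (n * 20) ≤ 5 ^ (51 * p) := Nat.pow_le_pow_right (by norm_num) (by omega)
      _ = (5 ^ 51) ^ p := by rw [pow_mul]
      _ ≤ _ := Nat.pow_le_pow_left (by norm_num) p
  exact absurd (Nat.pow_lt_pow_left h1 (by norm_num : (20 : ℕ) ≠ 0)) (not_lt.2 h2)

theorem no_solution_of_exponent_five {n y : ℕ} (hn : 3 ≤ n) (h5 : ¬ 5 ∣ n) (h : y ^ 5 + 4 ^ n = 5 ^ n) : False := by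
  have h' : (y ^ 5 + 4 ^ n) % 25 = 5 ^ n % 25 := by rw [h]
  have e5 : 5 ^ n % 25 = 0 := by
    obtain ⟨c, rfl⟩ : ∃ c, n = c + 2 := ⟨n - 2, by omega⟩
    rw [pow_add]; omega
  have e4 : 4 ^ n % 25 = 4 ^ (n % 10) % 25 := by
    conv_lhs => rw [← Nat.div_add_mod n 10, pow_add, pow_mul, Nat.mul_mod, Nat.pow_mod]
    norm_num
  have hm : n % 10 < 10 := Nat.mod_lt _ (by norm_num)
  have h5' : n % 10 ≠ 0 ∧ n % 10 ≠ 5 := by omega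
  have hy : y % 25 < 25 := Nat.mod_lt _ (by norm_num)
  rw [Nat.add_mod, e5, e4, Nat.pow_mod y] at h'
  obtain ⟨ha, hb⟩ := h5'
  revert h' ha hb
  generalize y % 25 = u at *
  generalize n % 10 = v at *
  clear e5 e4 h h5 hn
  revert u v
  decide

theorem Matrix.pow_dvd_det_of_columns {ι : Type*} [Fintype ι] [DecidableEq ι] (q : ℤ)
    (b : ℕ → ι → ℤ) (g : ι → ℕ → ℤ) (e : ι → ι → ℤ) :
    q ^ (∑ t ∈ Finset.range (Fintype.card ι), t) ∣
      Matrix.det (Matrix.of fun c a => ∑ t ∈ Finset.range (Fintype.card ι), q ^ t * g c t * b t a +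
        q ^ Fintype.card ι * e c a) := by
  set N := Fintype.card ι with hN
  let w : ι → ℕ → ι → ℤ := fun c t => if t < N then g c t • b t else e c
  have hrow : (Matrix.of fun c a => ∑ t ∈ Finset.range N, q ^ t * g c t * b t a + q ^ N * e c a) =
      (fun c => ∑ t : Fin (N + 1), q ^ (t : ℕ) • w c t) := by
    funext c a
    rw [Finset.sum_apply, Fin.sum_univ_eq_sum_range (fun t => (q ^ t • w c t) a) (N + 1),
      Finset.sum_range_succ, Matrix.of_apply]
    congr 1
    · refine Finset.sum_congr rfl fun t ht => ?_
      simp only [w, if_pos (Finset.mem_range.1 ht), Pi.smul_apply, smul_eq_mul]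
      ring
    · simp [w]
  have hdet := (Matrix.detRowAlternating (n := ι) (R := ℤ)).toMultilinearMap.map_sum
    (fun c (t : Fin (N + 1)) => q ^ (t : ℕ) • w c t)
  change Matrix.det (fun c => ∑ t : Fin (N + 1), q ^ (t : ℕ) • w c t) = _ at hdet
  rw [hrow, hdet]
  refine Finset.dvd_sum fun f _ => ?_
  change _ ∣ Matrix.det (fun c => q ^ (f c : ℕ) • w c (f c))
  have hsplit : (fun c => q ^ (f c : ℕ) • w c (f c)) = Matrix.of fun c a =>
      (q ^ (f c : ℕ) * if (f c : ℕ) < N then g c (f c) else 1) *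
        (if (f c : ℕ) < N then b (f c) a else e c a) := by
    funext c a
    by_cases hc : (f c : ℕ) < N
    · simp [w, hc, mul_assoc]
    · simp [w, hc]
  have hcolumn := Matrix.det_mul_column
    (fun c => q ^ (f c : ℕ) * if (f c : ℕ) < N then g c (f c) else 1)
    (Matrix.of fun c a => if (f c : ℕ) < N then b (f c) a else e c a)
  simp only [Matrix.of_apply] at hcolumn
  rw [hsplit, hcolumn]
  by_cases hinj : ∃ c c', c ≠ c' ∧ f c = f c' ∧ (f c : ℕ) < N
  · obtain ⟨c, c', hne, hff, hlt⟩ := hinj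
    rw [Matrix.det_zero_of_row_eq hne, mul_zero]
    · exact dvd_zero _
    · funext a
      simp [← hff, hlt]
  · push Not at hinj
    rw [Finset.prod_mul_distrib, Finset.prod_pow_eq_pow_sum, mul_assoc]
    refine Dvd.dvd.mul_right (pow_dvd_pow q ?_) _
    set s : Finset ι := Finset.univ.filter fun c => (f c : ℕ) < N
    have hinjs : Set.InjOn (fun c => (f c : ℕ)) s := by
      intro c hc c' hc' hcc
      by_contra hne
      have := hinj c c' hne (Fin.ext hcc)
      simp [s] at hc
      omega
    set T := s.image fun c => (f c : ℕ)
    have hT : T ⊆ Finset.range N := by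
      intro t ht
      simp only [T, s, Finset.mem_image, Finset.mem_filter, Finset.mem_univ, true_and] at ht
      obtain ⟨c, hc, rfl⟩ := ht
      exact Finset.mem_range.2 hc
    have hsum : ∑ c, (f c : ℕ) = ∑ t ∈ T, t + (N - T.card) * N := by
      rw [← Finset.sum_filter_add_sum_filter_not _ (fun c => (f c : ℕ) < N)]
      congr 1
      · exact (Finset.sum_image (f := fun t : ℕ => t) hinjs).symm
      · rw [Finset.sum_congr rfl (fun c hc => (by
          have := (f c).isLt
          simp at hc
          omega : (f c : ℕ) = N)), Finset.sum_const, smul_eq_mul, Finset.card_image_of_injOn hinjs,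
          Finset.filter_not, Finset.card_sdiff_of_subset (Finset.subset_univ _), Finset.card_univ]
    rw [hsum, ← Finset.sum_sdiff hT, add_comm]
    refine Nat.add_le_add_left ?_ _
    calc ∑ t ∈ Finset.range N \ T, t ≤ ∑ t ∈ Finset.range N \ T, N :=
          Finset.sum_le_sum fun t ht => (Finset.mem_range.1 (Finset.mem_sdiff.1 ht).1).le
      _ = (N - T.card) * N := by
          rw [Finset.sum_const, smul_eq_mul, Finset.card_sdiff_of_subset hT, Finset.card_range]

theorem choose_mul_one_add_pow (x : ℤ) (z i : ℕ) :
    (z.choose i : ℤ) * (1 + x) ^ z =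
      (1 + x) ^ i * ∑ t ∈ Finset.range (z + 1), (z.choose t : ℤ) * t.choose i * x ^ (t - i) := by
  rcases lt_or_ge z i with h | h
  · rw [Nat.choose_eq_zero_of_lt h, Finset.sum_eq_zero]
    · simp
    · intro t ht
      rw [Nat.choose_eq_zero_of_lt (show t < i by have := Finset.mem_range.1 ht; omega)]
      simp
  · obtain ⟨d, rfl⟩ := Nat.exists_eq_add_of_le h
    have hs : ∑ t ∈ Finset.range (i + d + 1), ((i + d).choose t : ℤ) * t.choose i * x ^ (t - i) =
        (i + d).choose i * (1 + x) ^ d := by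
      rw [show i + d + 1 = i + (d + 1) by ring, Finset.sum_range_add, Finset.sum_eq_zero, zero_add,
        add_comm 1 x, add_pow, Finset.mul_sum]
      · refine Finset.sum_congr rfl fun m hm => ?_
        have hm' := Finset.mem_range.1 hm
        have := Nat.choose_mul (n := i + d) (k := i + m) (s := i) (by omega)
        rw [show i + d - i = d by omega, show i + m - i = m by omega] at this
        rw [show i + m - i = m by omega, ← Nat.cast_mul, this]
        push_cast
        ring
      · intro t ht
        rw [Nat.choose_eq_zero_of_lt (Finset.mem_range.1 ht)]
        simp
    rw [hs, pow_add]
    ring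

theorem interpolation_det_dvd {K L n : ℕ} (q u : ℤ) (hu : q ∣ u - 1) (hn : K * L ≤ n)
    (z : Fin K × Fin L → ℕ) (w : Fin K × Fin L → ℤ) (hw : ∀ a, q ^ n ∣ w a - u ^ z a) (hq : q ≠ 0) :
    q ^ (K * K * ∑ j ∈ Finset.range L, j) ∣
      Matrix.det
        (Matrix.of fun c a : Fin K × Fin L => ((z a).choose c.1 : ℤ) * w a ^ (c.2 : ℕ)) := by
  set N := Fintype.card (Fin K × Fin L) with hN
  have hNKL : N = K * L := by simp [hN]
  have hv : ∀ c : Fin K × Fin L, ∃ v, u ^ (c.2 : ℕ) = 1 + q * v := by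
    intro c
    have := hu.trans (by simpa using sub_dvd_pow_sub_pow u 1 (c.2 : ℕ) : u - 1 ∣ u ^ (c.2 : ℕ) - 1)
    obtain ⟨v, hv⟩ := this
    exact ⟨v, by linarith⟩
  choose v hv using hv
  have hcol : ∀ c a : Fin K × Fin L, ∃ e : ℤ,
      q ^ (c.1 : ℕ) * (((z a).choose c.1 : ℤ) * w a ^ (c.2 : ℕ)) =
      ∑ t ∈ Finset.range N, q ^ t * ((u ^ (c.2 : ℕ)) ^ (c.1 : ℕ) * (t.choose c.1 * v c ^ (t - c.1))) *
        (z a).choose t + q ^ N * e := by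
    intro c a
    obtain ⟨ε, hε⟩ : q ^ N ∣ w a ^ (c.2 : ℕ) - (u ^ (c.2 : ℕ)) ^ z a := by
      have h1 : q ^ N ∣ w a - u ^ z a := (pow_dvd_pow q (hNKL ▸ hn)).trans (hw a)
      have h2 := h1.trans (sub_dvd_pow_sub_pow (w a) (u ^ z a) (c.2 : ℕ))
      rwa [← pow_mul, mul_comm (z a), pow_mul] at h2
    have hexp := choose_mul_one_add_pow (q * v c) (z a) c.1
    rw [← hv c] at hexp
    set F : ℕ → ℤ := fun t =>
      q ^ t * ((u ^ (c.2 : ℕ)) ^ (c.1 : ℕ) * (t.choose c.1 * v c ^ (t - c.1))) * (z a).choose t with hF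
    have hsum : q ^ (c.1 : ℕ) * (((z a).choose c.1 : ℤ) * (u ^ (c.2 : ℕ)) ^ z a) =
        ∑ t ∈ Finset.range (z a + 1 + N), F t := by
      rw [hexp, Finset.sum_range_add F (z a + 1) N]
      rw [Finset.sum_eq_zero (s := Finset.range N), add_zero, Finset.mul_sum, Finset.mul_sum]
      · refine Finset.sum_congr rfl fun t _ => ?_
        rcases lt_or_ge t c.1 with h | h
        · simp [hF, Nat.choose_eq_zero_of_lt h]
        · obtain ⟨d, rfl⟩ := Nat.exists_eq_add_of_le h
          simp only [hF, Nat.add_sub_cancel_left, mul_pow, pow_add]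
          ring
      · intro t _
        simp [hF, Nat.choose_eq_zero_of_lt (show z a < z a + 1 + t by omega)]
    have htail : q ^ N ∣ ∑ t ∈ Finset.range (z a + 1), F (N + t) := by
      refine Finset.dvd_sum fun t _ => ?_
      simp only [hF, mul_assoc]
      exact (pow_dvd_pow q (Nat.le_add_right N t)).mul_right _
    obtain ⟨τ, hτ⟩ := htail
    rw [add_comm (z a + 1) N, Finset.sum_range_add F N (z a + 1), hτ] at hsum
    refine ⟨τ + q ^ (c.1 : ℕ) * ((z a).choose c.1 : ℤ) * ε, ?_⟩
    have : w a ^ (c.2 : ℕ) = (u ^ (c.2 : ℕ)) ^ z a + q ^ N * ε := by linarith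
    rw [this, mul_add, mul_add, hsum]
    ring
  choose e he using hcol
  have hd := Matrix.pow_dvd_det_of_columns q (fun t a => ((z a).choose t : ℤ))
    (fun c t => (u ^ (c.2 : ℕ)) ^ (c.1 : ℕ) * (t.choose c.1 * v c ^ (t - c.1))) e
  simp only [← hN] at hd
  simp only [← he] at hd
  have hmul := Matrix.det_mul_column (fun c : Fin K × Fin L => q ^ (c.1 : ℕ))
    (Matrix.of fun c a : Fin K × Fin L => ((z a).choose c.1 : ℤ) * w a ^ (c.2 : ℕ))
  simp only [Matrix.of_apply] at hmul
  rw [hmul, Finset.prod_pow_eq_pow_sum] at hd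
  have hexp : ∑ t ∈ Finset.range N, t =
      ∑ c : Fin K × Fin L, (c.1 : ℕ) + K * K * ∑ j ∈ Finset.range L, j := by
    rw [Fintype.sum_prod_type]
    simp only [Finset.sum_const, Finset.card_univ, Fintype.card_fin, smul_eq_mul]
    rw [← Finset.mul_sum, Fin.sum_univ_eq_sum_range (fun i => i) K, hNKL]
    have h1 := Finset.sum_range_id_mul_two (K * L)
    have h2 := Finset.sum_range_id_mul_two K
    have h3 := Finset.sum_range_id_mul_two L
    rcases K with _ | K
    · simp
    rcases L with _ | L
    · simp
    obtain ⟨M, hM⟩ : ∃ M, (K + 1) * (L + 1) = M + 1 := ⟨K * L + K + L, by ring⟩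
    rw [hM] at h1 ⊢
    simp only [Nat.add_sub_cancel] at h1 h2 h3
    refine Nat.eq_of_mul_eq_mul_right (show 0 < 2 by norm_num) ?_
    rw [add_mul, h1, mul_assoc, mul_assoc, h2, h3, ← hM]
    nlinarith
  rw [hexp, pow_add] at hd
  exact (mul_dvd_mul_iff_left (pow_ne_zero _ hq)).1 hd

theorem Polynomial.coeff_prod_sum_of_natDegree_le {ι R : Type*} [CommSemiring R] (s : Finset ι)
    (f : ι → Polynomial R) (d : ι → ℕ) (h : ∀ i ∈ s, (f i).natDegree ≤ d i) :
    (∏ i ∈ s, f i).coeff (∑ i ∈ s, d i) = ∏ i ∈ s, (f i).coeff (d i) := by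
  classical
  induction s using Finset.induction_on with
  | empty => simp
  | insert a s ha ih =>
    rw [Finset.prod_insert ha, Finset.sum_insert ha, Finset.prod_insert ha,
      Polynomial.coeff_mul_add_eq_of_natDegree_le (h a (Finset.mem_insert_self a s)),
      ih fun i hi => h i (Finset.mem_insert_of_mem hi)]
    exact (Polynomial.natDegree_prod_le s f).trans
      (Finset.sum_le_sum fun i hi => h i (Finset.mem_insert_of_mem hi))

theorem Polynomial.eq_zero_of_exponential_sum_eq_zero {F : Type*} [Field F] [CharZero F]
    {K L R S p n : ℕ} {α y : F} (hy : y ≠ 0) (hα : Function.Injective fun j : ℕ => α ^ j)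
    (hpn : ∀ r s r' s', s < S → s' < S → r * p + s * n = r' * p + s' * n → r = r' ∧ s = s')
    (hcard : L * (K - 1) < R * S) (P : Fin L → Polynomial F) (hdeg : ∀ j, (P j).natDegree ≤ K - 1)
    (hzero : ∀ r s, r < R + L - 1 → s < S →
      ∑ j, (P j).eval ((r * p + s * n : ℕ) : F) * (α ^ r * y ^ s) ^ (j : ℕ) = 0) :
    ∀ j, P j = 0 := by
  classical
  have hα0 : α ≠ 0 := by
    rintro rfl
    have := @hα 1 2 (by simp)
    omega
  set J : Finset (Fin L) := Finset.univ.filter fun j => P j ≠ 0 with hJ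
  by_contra hne
  push Not at hne
  obtain ⟨j₀, hj₀⟩ := hne
  have hcardJ : J.card ≤ L := by simpa using Finset.card_le_univ J
  have hpos : 0 < J.card := Finset.card_pos.2 ⟨j₀, by simp [hJ, hj₀]⟩
  set g := J.orderEmbOfFin rfl with hg
  have hgP : ∀ b, P (g b) ≠ 0 := fun b => by
    exact (Finset.mem_filter.1 (J.orderEmbOfFin_mem rfl b)).2
  set M : Matrix (Fin J.card) (Fin J.card) (Polynomial F) := Matrix.of fun a b =>
    Polynomial.C ((α ^ (g b : ℕ)) ^ (a : ℕ)) *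
      (P (g b)).comp (Polynomial.X + Polynomial.C ((a * p : ℕ) : F)) with hM
  set d : Fin J.card → ℕ := fun b => (P (g b)).natDegree with hd
  have hdegcomp : ∀ a b : Fin J.card,
      ((P (g b)).comp (Polynomial.X + Polynomial.C ((a * p : ℕ) : F))).natDegree = d b := by
    intro a b
    rw [Polynomial.natDegree_comp, Polynomial.natDegree_X_add_C, mul_one]
  have hdegM : ∀ a b, (M a b).natDegree ≤ d b := fun a b =>
    (Polynomial.natDegree_C_mul_le _ _).trans (hdegcomp a b).le
  have hcoeffM : ∀ a b, (M a b).coeff (d b) =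
      (P (g b)).leadingCoeff * (α ^ (g b : ℕ)) ^ (a : ℕ) := by
    intro a b
    simp only [hM, Matrix.of_apply, Polynomial.coeff_C_mul]
    rw [mul_comm]
    congr 1
    rw [← hdegcomp a b, Polynomial.coeff_natDegree, Polynomial.leadingCoeff_comp
      (by rw [Polynomial.natDegree_X_add_C]; exact one_ne_zero), Polynomial.leadingCoeff_X_add_C,
      one_pow, mul_one]
  have hdet : M.det ≠ 0 := by
    intro h0
    have h1 : M.det.coeff (∑ b, d b) =
        Matrix.det (Matrix.of fun a b => (P (g b)).leadingCoeff * (α ^ (g b : ℕ)) ^ (a : ℕ)) := by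
      rw [Matrix.det_apply, Matrix.det_apply, Polynomial.finsetSum_coeff]
      refine Finset.sum_congr rfl fun σ _ => ?_
      rw [Polynomial.coeff_smul,
        Polynomial.coeff_prod_sum_of_natDegree_le _ _ _ fun b _ => hdegM (σ b) b]
      simp [hcoeffM]
    rw [h0, Polynomial.coeff_zero] at h1
    have h2 := Matrix.det_mul_row (fun b => (P (g b)).leadingCoeff)
      (Matrix.vandermonde fun b => α ^ (g b : ℕ)).transpose
    simp only [Matrix.transpose_apply, Matrix.vandermonde_apply] at h2
    rw [h2, Matrix.det_transpose] at h1
    refine mul_ne_zero (Finset.prod_ne_zero_iff.2 fun b _ => ?_)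
      (Matrix.det_vandermonde_ne_zero_iff.2 ?_) h1.symm
    · exact Polynomial.leadingCoeff_ne_zero.2 (hgP b)
    · intro b b' hbb
      exact g.injective (Fin.ext (hα hbb))
  have hroot : ∀ r s, r < R → s < S → M.det.eval ((r * p + s * n : ℕ) : F) = 0 := by
    intro r s hr hs
    rw [← Polynomial.coe_evalRingHom, RingHom.map_det]
    refine Matrix.exists_mulVec_eq_zero_iff.1
      ⟨fun b => (α ^ r * y ^ s) ^ (g b : ℕ), fun h => ?_, ?_⟩
    · have := congrFun h ⟨0, hpos⟩
      exact pow_ne_zero _ (mul_ne_zero (pow_ne_zero _ hα0) (pow_ne_zero _ hy)) this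
    · funext a
      have hz := hzero (r + a) s (by have := a.isLt; omega) hs
      rw [← Finset.sum_subset (Finset.subset_univ J)] at hz
      · have hsum : ∀ φ : Fin L → F, ∑ j ∈ J, φ j = ∑ b, φ (g b) := fun φ => by
          conv_lhs => rw [← J.image_orderEmbOfFin_univ rfl]
          exact Finset.sum_image g.injective.injOn
        rw [hsum] at hz
        rw [Pi.zero_apply, ← hz]
        simp only [Matrix.mulVec, dotProduct]
        refine Finset.sum_congr rfl fun b _ => ?_
        simp only [hM, RingHom.mapMatrix_apply, Matrix.map_apply, Matrix.of_apply,
          Polynomial.coe_evalRingHom, Polynomial.eval_mul, Polynomial.eval_C, Polynomial.eval_comp,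
          Polynomial.eval_add, Polynomial.eval_X]
        push_cast
        ring_nf
      · intro j _ hj
        have : P j = 0 := by simpa [hJ] using hj
        simp [this]
  refine hdet (Polynomial.eq_zero_of_natDegree_lt_card_of_eval_eq_zero' M.det
    ((Finset.range R ×ˢ Finset.range S).image fun a => ((a.1 * p + a.2 * n : ℕ) : F)) ?_ ?_)
  · intro x hx
    simp only [Finset.mem_image, Finset.mem_product, Finset.mem_range] at hx
    obtain ⟨a, ⟨h1, h2⟩, rfl⟩ := hx
    exact hroot _ _ h1 h2
  · rw [Finset.card_image_of_injOn, Finset.card_product, Finset.card_range, Finset.card_range]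
    · refine lt_of_le_of_lt ?_ hcard
      rw [Matrix.det_apply]
      refine Polynomial.natDegree_sum_le_of_forall_le _ _ fun σ _ => ?_
      refine (Polynomial.natDegree_smul_le _ _).trans
        ((Polynomial.natDegree_prod_le _ _).trans ?_)
      calc ∑ b, (M (σ b) b).natDegree ≤ ∑ b : Fin J.card, (K - 1) :=
            Finset.sum_le_sum fun b _ => (hdegM _ _).trans (hdeg _)
        _ = J.card * (K - 1) := by simp
        _ ≤ L * (K - 1) := Nat.mul_le_mul_right _ hcardJ
    · rintro ⟨r, s⟩ h1 ⟨r', s'⟩ h2 h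
      simp only [Finset.coe_product, Finset.coe_range, Set.mem_prod, Set.mem_Iio] at h1 h2
      have := hpn r s r' s' h1.2 h2.2 (Nat.cast_injective h)
      exact Prod.ext this.1 this.2

theorem Matrix.exists_submatrix_det_ne_zero {ι κ F : Type*} [Fintype ι] [DecidableEq ι] [Fintype κ]
    [Field F] (A : Matrix ι κ F) (h : ∀ c, Matrix.vecMul c A = 0 → c = 0) :
    ∃ σ : ι → κ, Function.Injective σ ∧ (A.submatrix id σ).det ≠ 0 := by
  have hrow : LinearIndependent F A.row := by
    rw [Fintype.linearIndependent_iff]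
    intro c hc i
    refine congrFun (h c ?_) i
    rw [Matrix.vecMul_eq_sum]
    exact hc
  have hrank : A.rank = Fintype.card ι := hrow.rank_matrix
  obtain ⟨κ', a, ha, hspan, hli⟩ := exists_linearIndependent' F A.col
  have : Finite κ' := Finite.of_injective a ha
  have : Fintype κ' := Fintype.ofFinite κ'
  have hcard : Fintype.card ι = Fintype.card κ' := by
    rw [← hrank, Matrix.rank_eq_finrank_span_cols, ← hspan]
    exact finrank_span_eq_card hli
  refine ⟨a ∘ Fintype.equivOfCardEq hcard, ha.comp (Equiv.injective _), ?_⟩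
  have hcol : LinearIndependent F (A.submatrix id (a ∘ Fintype.equivOfCardEq hcard)).col :=
    hli.comp _ (Fintype.equivOfCardEq hcard).injective
  rw [Matrix.linearIndependent_cols_iff_isUnit, Matrix.isUnit_iff_isUnit_det] at hcol
  exact hcol.ne_zero

theorem eq_zero_of_sum_choose_eq_zero {K : ℕ} (c : Fin K → ℚ)
    (h : ∀ m : ℕ, ∑ i : Fin K, c i * (m.choose i : ℚ) = 0) : ∀ i, c i = 0 := by
  suffices ∀ m : ℕ, ∀ i : Fin K, (i : ℕ) = m → c i = 0 from fun i => this i i rfl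
  intro m
  induction m using Nat.strong_induction_on with
  | _ m ih =>
    rintro i rfl
    have := h i
    rw [Finset.sum_eq_single i] at this
    · simpa using this
    · intro b _ hb
      rcases lt_trichotomy (b : ℕ) i with hlt | heq | hgt
      · rw [ih b hlt b rfl, zero_mul]
      · exact absurd (Fin.ext heq) hb
      · rw [Nat.choose_eq_zero_of_lt hgt, Nat.cast_zero, mul_zero]
    · simp

theorem exists_interpolation_det_ne_zero {K L R S p n : ℕ} {α y : ℤ} (hy : y ≠ 0)
    (hα : Function.Injective fun j : ℕ => α ^ j)
    (hpn : ∀ r s r' s', s < S → s' < S → r * p + s * n = r' * p + s' * n → r = r' ∧ s = s')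
    (hcard : L * (K - 1) < R * S) :
    ∃ σ : Fin K × Fin L → Fin (R + L - 1) × Fin S, Function.Injective σ ∧
      Matrix.det (Matrix.of fun c a : Fin K × Fin L =>
        ((((σ a).1 * p + (σ a).2 * n).choose c.1 : ℕ) : ℤ) *
          (α ^ ((σ a).1 : ℕ) * y ^ ((σ a).2 : ℕ)) ^ (c.2 : ℕ)) ≠ 0 := by
  let A : Matrix (Fin K × Fin L) (Fin (R + L - 1) × Fin S) ℚ := Matrix.of fun c a =>
    (((a.1 * p + a.2 * n).choose c.1 : ℕ) : ℚ) *
      ((α : ℚ) ^ (a.1 : ℕ) * (y : ℚ) ^ (a.2 : ℕ)) ^ (c.2 : ℕ)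
  obtain ⟨σ, hσ, hdet⟩ := A.exists_submatrix_det_ne_zero (by
    intro c hc
    let P : Fin L → Polynomial ℚ := fun j => ∑ i : Fin K,
      Polynomial.C (c (i, j) / (i : ℕ).factorial) * descPochhammer ℚ i
    have hPeval : ∀ j (m : ℕ), (P j).eval (m : ℚ) = ∑ i : Fin K, c (i, j) * (m.choose i : ℚ) := by
      intro j m
      rw [Polynomial.eval_finsetSum]
      refine Finset.sum_congr rfl fun i _ => ?_
      rw [Polynomial.eval_mul, Polynomial.eval_C, descPochhammer_eval_eq_descFactorial,
        Nat.descFactorial_eq_factorial_mul_choose]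
      have := Nat.factorial_ne_zero (i : ℕ)
      push_cast
      field_simp
    have hP := Polynomial.eq_zero_of_exponential_sum_eq_zero (α := (α : ℚ)) (y := y)
      (by exact_mod_cast hy) (fun i j hij => hα (by
        have hij' : (α : ℚ) ^ i = (α : ℚ) ^ j := hij
        exact_mod_cast hij')) hpn hcard P (fun j => by
          refine Polynomial.natDegree_sum_le_of_forall_le _ _ fun i _ => ?_
          refine (Polynomial.natDegree_C_mul_le _ _).trans ?_
          rw [descPochhammer_natDegree]
          have := i.isLt
          omega) (fun r s hr hs => by
          have h1 := congrFun hc (⟨r, hr⟩, ⟨s, hs⟩)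
          simp only [Matrix.vecMul, dotProduct, A, Matrix.of_apply, Pi.zero_apply,
            Fintype.sum_prod_type] at h1
          rw [Finset.sum_comm] at h1
          rw [← h1]
          refine Finset.sum_congr rfl fun j _ => ?_
          rw [hPeval, Finset.sum_mul]
          refine Finset.sum_congr rfl fun i _ => ?_
          ring)
    funext a
    refine eq_zero_of_sum_choose_eq_zero (fun i => c (i, a.2)) (fun m => ?_) a.1
    rw [← hPeval, hP, Polynomial.eval_zero])
  refine ⟨σ, hσ, fun h0 => hdet ?_⟩
  have h1 := congrArg (Int.castRingHom ℚ) h0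
  rw [RingHom.map_det, map_zero] at h1
  rw [← h1]
  congr 1
  ext c a
  simp [A]

theorem three_mul_sum_sq_centered (n : ℕ) :
    (3 : ℤ) * ∑ i : Fin n, (2 * (i : ℤ) - (n - 1)) ^ 2 = (n : ℤ) ^ 3 - n := by
  have h : ∀ (c : ℤ) (m : ℕ), (3 : ℤ) * ∑ i ∈ Finset.range m, (2 * (i : ℤ) - c) ^ 2 =
      2 * m * (m - 1) * (2 * m - 1) - 6 * c * m * (m - 1) + 3 * c ^ 2 * m := by
    intro c m
    induction m with
    | zero => simp
    | succ m ih =>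
      rw [Finset.sum_range_succ, mul_add, ih]
      push_cast
      ring
  rw [Fin.sum_univ_eq_sum_range (fun i => (2 * (i : ℤ) - (n - 1)) ^ 2) n, h]
  ring

theorem sum_centered_eq_zero (n : ℕ) : ∑ i : Fin n, (2 * (i : ℤ) - (n - 1)) = (0 : ℤ) := by
  have h : ∀ (c : ℤ) (m : ℕ), ∑ i ∈ Finset.range m, (2 * (i : ℤ) - c) = m * (m - 1) - c * m := by
    intro c m
    induction m with
    | zero => simp
    | succ m ih =>
      rw [Finset.sum_range_succ, ih]
      push_cast
      ring
  rw [Fin.sum_univ_eq_sum_range (fun i => 2 * (i : ℤ) - (n - 1)) n, h]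
  ring

theorem permuted_sum_variation {K L R S : ℕ} (σ : Fin K × Fin L → Fin R × Fin S)
    (hσ : Function.Injective σ) (π π' : Equiv.Perm (Fin K × Fin L)) :
    36 * ((∑ c, ((σ (π c)).1 : ℤ) * (c.2 : ℤ)) - ∑ c, ((σ (π' c)).1 : ℤ) * (c.2 : ℤ)) ^ 2 ≤
      S * R ^ 3 * K * L ^ 3 := by
  set X : Equiv.Perm (Fin K × Fin L) → ℤ := fun π =>
    ∑ c, (2 * ((σ (π c)).1 : ℤ) - (R - 1)) * (2 * (c.2 : ℤ) - (L - 1)) with hX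
  have hzero : ∑ c : Fin K × Fin L, (2 * (c.2 : ℤ) - (L - 1)) = 0 := by
    rw [Fintype.sum_prod_type]
    simp only [sum_centered_eq_zero, Finset.sum_const_zero]
  have hXeq : ∀ π, X π = 4 * ∑ c, ((σ (π c)).1 : ℤ) * (c.2 : ℤ) -
      2 * (L - 1) * ∑ c, ((σ c).1 : ℤ) := by
    intro π
    have h1 : X π = 4 * ∑ c, ((σ (π c)).1 : ℤ) * (c.2 : ℤ) -
        2 * (L - 1) * ∑ c, ((σ (π c)).1 : ℤ) -
        (R - 1) * ∑ c : Fin K × Fin L, (2 * (c.2 : ℤ) - (L - 1)) := by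
      simp only [hX, Finset.mul_sum, ← Finset.sum_sub_distrib]
      refine Finset.sum_congr rfl fun c _ => ?_
      ring
    rw [h1, hzero, Equiv.sum_comp π fun c => ((σ c).1 : ℤ)]
    ring
  have hA : ∀ π : Equiv.Perm (Fin K × Fin L),
      (3 : ℤ) * ∑ c, (2 * ((σ (π c)).1 : ℤ) - (R - 1)) ^ 2 ≤ (S : ℤ) * (R : ℤ) ^ 3 := by
    intro π
    have h1 : ∑ c, (2 * ((σ (π c)).1 : ℤ) - (R - 1)) ^ 2 ≤
        ∑ a : Fin R × Fin S, (2 * (a.1 : ℤ) - (R - 1)) ^ 2 := by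
      rw [← Finset.sum_image (s := Finset.univ) (g := fun c => σ (π c))
        (f := fun a : Fin R × Fin S => (2 * (a.1 : ℤ) - (R - 1)) ^ 2)
        ((hσ.comp π.injective).injOn)]
      exact Finset.sum_le_sum_of_subset_of_nonneg (Finset.subset_univ _)
        fun _ _ _ => sq_nonneg _
    have h2 : (3 : ℤ) * ∑ a : Fin R × Fin S, (2 * (a.1 : ℤ) - (R - 1)) ^ 2 =
        (S : ℤ) * ((R : ℤ) ^ 3 - R) := by
      rw [Fintype.sum_prod_type]
      simp only [Finset.sum_const, Finset.card_univ, Fintype.card_fin, nsmul_eq_mul]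
      rw [← Finset.mul_sum, ← three_mul_sum_sq_centered]
      ring
    have : (0 : ℤ) ≤ S * R := by positivity
    nlinarith
  have hB : (3 : ℤ) * ∑ c : Fin K × Fin L, (2 * (c.2 : ℤ) - (L - 1)) ^ 2 ≤ (K : ℤ) * (L : ℤ) ^ 3 := by
    rw [Fintype.sum_prod_type]
    simp only [Finset.sum_const, Finset.card_univ, Fintype.card_fin, nsmul_eq_mul]
    have h := three_mul_sum_sq_centered L
    have : (0 : ℤ) ≤ K * L := by positivity
    calc (3 : ℤ) * (K * ∑ i : Fin L, (2 * (i : ℤ) - (L - 1)) ^ 2) = K * ((L : ℤ) ^ 3 - L) := by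
          rw [← h]; ring
      _ ≤ K * L ^ 3 := by nlinarith
  have hCS : ∀ π, 9 * X π ^ 2 ≤ S * R ^ 3 * K * L ^ 3 := by
    intro π
    have h1 := Finset.sum_mul_sq_le_sq_mul_sq Finset.univ
      (fun c => 2 * ((σ (π c)).1 : ℤ) - (R - 1))
      (fun c : Fin K × Fin L => 2 * (c.2 : ℤ) - (L - 1))
    have h2 := mul_le_mul (hA π) hB
      (mul_nonneg (by norm_num) (Finset.sum_nonneg fun _ _ => sq_nonneg _)) (by positivity)
    calc 9 * X π ^ 2 ≤ 9 * _ := mul_le_mul_of_nonneg_left h1 (by norm_num)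
      _ = _ := by ring
      _ ≤ _ := h2
      _ = _ := by ring
  have h1 := hCS π
  have h2 := hCS π'
  have h3 : X π - X π' = 4 * ((∑ c, ((σ (π c)).1 : ℤ) * (c.2 : ℤ)) -
      ∑ c, ((σ (π' c)).1 : ℤ) * (c.2 : ℤ)) := by
    rw [hXeq, hXeq]; ring
  have h4 := congrArg (fun t => t ^ 2) h3
  simp only [mul_pow] at h4
  nlinarith [sq_nonneg (X π + X π')]

theorem interpolation_det_bound {K L R S p n E : ℕ} {y : ℤ} (hy : 0 < y) (hy5 : IsCoprime 5 y)
    (σ : Fin K × Fin L → Fin R × Fin S) (hσ : Function.Injective σ)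
    (hdvd : 5 ^ E ∣ Matrix.det (Matrix.of fun c a : Fin K × Fin L =>
        ((((σ a).1 * p + (σ a).2 * n).choose c.1 : ℕ) : ℤ) *
          ((-4) ^ ((σ a).1 : ℕ) * y ^ ((σ a).2 : ℕ)) ^ (c.2 : ℕ)))
    (hdet : Matrix.det (Matrix.of fun c a : Fin K × Fin L =>
        ((((σ a).1 * p + (σ a).2 * n).choose c.1 : ℕ) : ℤ) *
          ((-4) ^ ((σ a).1 : ℕ) * y ^ ((σ a).2 : ℕ)) ^ (c.2 : ℕ)) ≠ 0) :
    ∃ d e : ℕ, 36 * d ^ 2 ≤ S * R ^ 3 * K * L ^ 3 ∧ 36 * e ^ 2 ≤ R * S ^ 3 * K * L ^ 3 ∧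
      (5 : ℤ) ^ E ≤ (K * L).factorial *
        (∏ i ∈ Finset.range K, (((R - 1) * p + (S - 1) * n).choose i : ℤ)) ^ L * 4 ^ d * y ^ e := by
  classical
  set Z := (R - 1) * p + (S - 1) * n with hZ
  set ρ : Equiv.Perm (Fin K × Fin L) → ℕ := fun π => ∑ c, ((σ (π c)).1 : ℕ) * (c.2 : ℕ) with hρ
  set τ : Equiv.Perm (Fin K × Fin L) → ℕ := fun π => ∑ c, ((σ (π c)).2 : ℕ) * (c.2 : ℕ) with hτ
  obtain ⟨π₀, hπ₀⟩ := Finite.exists_min ρ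
  obtain ⟨π₁, hπ₁⟩ := Finite.exists_max ρ
  obtain ⟨π₂, hπ₂⟩ := Finite.exists_min τ
  obtain ⟨π₃, hπ₃⟩ := Finite.exists_max τ
  set D' : ℤ := ∑ π : Equiv.Perm (Fin K × Fin L), (Equiv.Perm.sign π : ℤ) *
    ((∏ c, (((σ (π c)).1 * p + (σ (π c)).2 * n).choose c.1 : ℤ)) *
      ((-4) ^ (ρ π - ρ π₀) * y ^ (τ π - τ π₂))) with hD'
  have hfac : Matrix.det (Matrix.of fun c a : Fin K × Fin L =>
        ((((σ a).1 * p + (σ a).2 * n).choose c.1 : ℕ) : ℤ) *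
          ((-4) ^ ((σ a).1 : ℕ) * y ^ ((σ a).2 : ℕ)) ^ (c.2 : ℕ)) =
      (-4) ^ ρ π₀ * y ^ τ π₂ * D' := by
    rw [← Matrix.det_transpose, Matrix.det_apply', hD', Finset.mul_sum]
    refine Finset.sum_congr rfl fun π _ => ?_
    simp only [Matrix.transpose_apply, Matrix.of_apply, mul_pow, Finset.prod_mul_distrib, ← pow_mul,
      Finset.prod_pow_eq_pow_sum]
    have h1 : ((-4 : ℤ)) ^ ρ π = (-4) ^ ρ π₀ * (-4) ^ (ρ π - ρ π₀) := by
      rw [← pow_add, Nat.add_sub_cancel' (hπ₀ π)]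
    have h2 : y ^ τ π = y ^ τ π₂ * y ^ (τ π - τ π₂) := by
      rw [← pow_add, Nat.add_sub_cancel' (hπ₂ π)]
    rw [Int.cast_id]
    change _ * (_ * ((-4) ^ ρ π * y ^ τ π)) = _
    rw [h1, h2]
    generalize (∏ x : Fin K × Fin L, ((((σ (π x)).1 * p + (σ (π x)).2 * n).choose x.1 : ℕ) : ℤ)) = Q
    ring
  rw [hfac] at hdvd hdet
  have hcop : IsCoprime ((5 : ℤ) ^ E) ((-4) ^ ρ π₀ * y ^ τ π₂) := by
    refine IsCoprime.pow_left (IsCoprime.mul_right (IsCoprime.pow_right ?_) (hy5.pow_right))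
    exact ⟨1, 1, by norm_num⟩
  have hdvd' := hcop.dvd_of_dvd_mul_left hdvd
  have hD0 : D' ≠ 0 := right_ne_zero_of_mul hdet
  have hle : (5 : ℤ) ^ E ≤ |D'| := Int.le_of_dvd (abs_pos.2 hD0) ((dvd_abs _ _).2 hdvd')
  refine ⟨ρ π₁ - ρ π₀, τ π₃ - τ π₂, ?_, ?_, hle.trans ?_⟩
  · have h := permuted_sum_variation σ hσ π₁ π₀
    have h2 := hπ₀ π₁
    zify [h2]
    simpa [hρ] using h
  · have h := permuted_sum_variation (fun c => (σ c).swap) (Prod.swap_injective.comp hσ) π₃ π₂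
    have h2 := hπ₂ π₃
    zify [h2]
    simpa [hτ] using h
  · refine (Finset.abs_sum_le_sum_abs _ _).trans ?_
    have hterm : ∀ π ∈ (Finset.univ : Finset (Equiv.Perm (Fin K × Fin L))),
        |(Equiv.Perm.sign π : ℤ) *
          ((∏ c, (((σ (π c)).1 * p + (σ (π c)).2 * n).choose c.1 : ℤ)) *
          ((-4) ^ (ρ π - ρ π₀) * y ^ (τ π - τ π₂)))| ≤
        (∏ i ∈ Finset.range K, (Z.choose i : ℤ)) ^ L * (4 ^ (ρ π₁ - ρ π₀) * y ^ (τ π₃ - τ π₂)) := by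
      intro π _
      rw [abs_mul, abs_mul, abs_mul, abs_pow, abs_pow, abs_of_pos hy]
      have hs : |((Equiv.Perm.sign π : ℤˣ) : ℤ)| = 1 := by
        rcases Int.units_eq_one_or (Equiv.Perm.sign π) with h | h <;> simp [h]
      rw [hs, one_mul]
      refine mul_le_mul ?_ (mul_le_mul ?_ ?_ (by positivity) (by positivity)) (by positivity)
        (pow_nonneg (Finset.prod_nonneg fun _ _ => Nat.cast_nonneg _) L)
      · rw [Finset.abs_prod]
        calc ∏ c, |(((σ (π c)).1 * p + (σ (π c)).2 * n).choose c.1 : ℤ)| ≤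
            ∏ c : Fin K × Fin L, (Z.choose c.1 : ℤ) := by
              refine Finset.prod_le_prod (fun _ _ => abs_nonneg _) fun c _ => ?_
              rw [Nat.abs_cast]
              refine Int.ofNat_le.2 (Nat.choose_le_choose _ ?_)
              have h1 := (σ (π c)).1.isLt
              have h2 := (σ (π c)).2.isLt
              exact Nat.add_le_add (Nat.mul_le_mul_right _ (by omega))
                (Nat.mul_le_mul_right _ (by omega))
          _ = _ := by
              rw [Fintype.prod_prod_type]
              simp only [Finset.prod_const, Finset.card_univ, Fintype.card_fin]
              rw [Finset.prod_pow, Fin.prod_univ_eq_prod_range (fun i => (Z.choose i : ℤ)) K]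
      · norm_num
        exact pow_le_pow_right₀ (by norm_num) (Nat.sub_le_sub_right (hπ₁ π) _)
      · exact pow_le_pow_right₀ (by omega) (Nat.sub_le_sub_right (hπ₃ π) _)
    refine (Finset.sum_le_card_nsmul _ _ _ hterm).trans ?_
    rw [Finset.card_univ, Fintype.card_perm, Fintype.card_prod, Fintype.card_fin, Fintype.card_fin,
      nsmul_eq_mul]
    exact le_of_eq (by ring)

theorem interpolation_inequality {p n K L R S y : ℕ} (hp : p.Prime) (hp5 : p ≠ 5) (hpn : ¬ p ∣ n)
    (hodd : Odd n) (hy5 : y % 5 = 1) (h : y ^ p + 4 ^ n = 5 ^ n) (hKL : K * L ≤ n) (hS : S ≤ p)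
    (hcard : L * (K - 1) < R * S) :
    ∃ d e : ℕ, 36 * d ^ 2 ≤ S * (R + L - 1) ^ 3 * K * L ^ 3 ∧
      36 * e ^ 2 ≤ (R + L - 1) * S ^ 3 * K * L ^ 3 ∧
      5 ^ (K * K * ∑ j ∈ Finset.range L, j) ≤ (K * L).factorial *
        (∏ i ∈ Finset.range K, ((R + L - 1 - 1) * p + (S - 1) * n).choose i) ^ L *
          4 ^ d * y ^ e := by
  have hy0 : 0 < y := by omega
  have hyZ : (5 : ℤ) ∣ y - 1 := by omega
  obtain ⟨σ, hσ, hdet⟩ := exists_interpolation_det_ne_zero (K := K) (L := L) (R := R) (S := S)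
    (p := p) (n := n) (α := -4) (y := y) (by exact_mod_cast hy0.ne')
    (fun i j hij => by
      have := congrArg Int.natAbs hij
      simp only [Int.natAbs_pow] at this
      exact Nat.pow_right_injective (le_refl 2 |>.trans (by norm_num : 2 ≤ (-4 : ℤ).natAbs)) this)
    (fun r s r' s' hs hs' hrs => by
      have h1 : s * n ≡ s' * n [MOD p] := by
        have := congrArg (· % p) hrs
        simpa [Nat.ModEq, Nat.add_mod, Nat.mul_mod] using this
      have h2 : s ≡ s' [MOD p] :=
        h1.cancel_right_of_coprime ((Nat.Prime.coprime_iff_not_dvd hp).2 hpn)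
      have h3 : s = s' := by
        have := h2
        rwa [Nat.ModEq, Nat.mod_eq_of_lt (by omega), Nat.mod_eq_of_lt (by omega)] at this
      subst h3
      exact ⟨Nat.eq_of_mul_eq_mul_right hp.pos (by omega), rfl⟩) hcard
  have hcop : Nat.Coprime p (5 ^ n) :=
    Nat.Coprime.pow_right n ((Nat.coprime_primes hp (by norm_num)).2 hp5)
  obtain ⟨p', hp'⟩ : ∃ p', p * p' ≡ 1 [MOD 5 ^ n] := by
    obtain ⟨m, hm⟩ := Nat.exists_mul_mod_eq_one_of_coprime hcop
      (Nat.one_lt_pow hodd.pos.ne' (by norm_num))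
    exact ⟨m, by rw [Nat.ModEq, hm.2, Nat.mod_eq_of_lt (Nat.one_lt_pow hodd.pos.ne' (by norm_num))]⟩
  have hone : ∀ x : ℤ, 5 ∣ x - 1 → ∀ m : ℕ, m ≡ 1 [MOD 5 ^ n] → (5 : ℤ) ^ n ∣ x ^ m - x := by
    intro x hx m hm
    have h1m : 1 ≤ m := by
      by_contra h0
      obtain rfl : m = 0 := by omega
      have := (Nat.modEq_zero_iff_dvd.1 hm.symm)
      exact absurd (Nat.le_of_dvd one_pos this)
        (not_le.2 (Nat.one_lt_pow hodd.pos.ne' (by norm_num)))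
    obtain ⟨t, ht⟩ := (Nat.modEq_iff_dvd' h1m).1 hm.symm
    obtain rfl : m = 1 + 5 ^ n * t := by omega
    have h1 := dvd_sub_pow_of_dvd_sub (R := ℤ) (p := 5) (a := x) (b := 1) (by simpa using hx) n
    rw [one_pow] at h1
    have h2 := (((pow_dvd_pow _ (Nat.le_succ n)).trans h1).trans
      (by simpa using sub_dvd_pow_sub_pow (x ^ 5 ^ n) 1 t)).mul_left x
    rw [pow_add, pow_mul, pow_one, ← mul_sub_one]
    exact_mod_cast h2
  have hα : (5 : ℤ) ∣ -4 - 1 := by norm_num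
  set u : ℤ := (-4) ^ p' with hu
  have hu1 : (5 : ℤ) ∣ u - 1 := hα.trans (by simpa using sub_dvd_pow_sub_pow (-4 : ℤ) 1 p')
  have hup : (5 : ℤ) ^ n ∣ u ^ p - (-4) := by
    rw [hu, ← pow_mul, mul_comm]
    exact hone _ hα _ hp'
  have hun : (5 : ℤ) ^ n ∣ u ^ n - y := by
    have h1 : (5 : ℤ) ^ n ∣ (-4) ^ n - (y : ℤ) ^ p := by
      rw [hodd.neg_pow]
      refine ⟨-1, ?_⟩
      have : (y : ℤ) ^ p + 4 ^ n = 5 ^ n := by exact_mod_cast h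
      linarith
    have h2 := (h1.trans (sub_dvd_pow_sub_pow _ _ p'))
    rw [← pow_mul, ← pow_mul, mul_comm n] at h2
    have h3 := hone y hyZ _ hp'
    rw [hu, ← pow_mul]
    simpa using dvd_add h2 h3
  have hdvd := interpolation_det_dvd (K := K) (L := L) (n := n) 5 u hu1 hKL
    (fun a => (σ a).1 * p + (σ a).2 * n) (fun a => (-4) ^ ((σ a).1 : ℕ) * y ^ ((σ a).2 : ℕ))
    (fun a => by
      have h1 := hup.trans (sub_dvd_pow_sub_pow (u ^ p) (-4) ((σ a).1 : ℕ))
      have h2 := hun.trans (sub_dvd_pow_sub_pow (u ^ n) (y : ℤ) ((σ a).2 : ℕ))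
      rw [pow_add, mul_comm ((σ a).1 : ℕ), mul_comm ((σ a).2 : ℕ), pow_mul, pow_mul, ← dvd_neg]
      have h3 := dvd_add (h1.mul_right ((u ^ n) ^ ((σ a).2 : ℕ)))
        (h2.mul_left ((-4) ^ ((σ a).1 : ℕ)))
      convert h3 using 1
      ring) (by norm_num)
  obtain ⟨d, e, hd, he, hle⟩ := interpolation_det_bound (y := y) (by exact_mod_cast hy0)
    (by
      have : IsCoprime (5 : ℤ) ((1 : ℤ) + 5 * ((y - 1) / 5)) := ⟨-((y - 1) / 5), 1, by ring⟩
      rwa [Int.mul_ediv_cancel' hyZ, add_sub_cancel] at this) σ hσ hdvd hdet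
  exact ⟨d, e, by exact_mod_cast hd, by exact_mod_cast he, by exact_mod_cast hle⟩

theorem prod_choose_le {K Z : ℕ} {W : ℝ} (hK : 0 < K) (hZ : (Z : ℝ) / K ≤ W) :
    (∏ i ∈ Finset.range K, (Z.choose i : ℝ)) ≤
      W ^ (∑ i ∈ Finset.range K, i) * Real.exp ((K : ℝ) * K) := by
  have hK' : (0 : ℝ) < K := by exact_mod_cast hK
  have hW : 0 ≤ W := le_trans (by positivity) hZ
  calc (∏ i ∈ Finset.range K, (Z.choose i : ℝ)) ≤
        ∏ i ∈ Finset.range K, W ^ i * Real.exp K := by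
        refine Finset.prod_le_prod (fun i _ => Nat.cast_nonneg _) fun i _ => ?_
        calc (Z.choose i : ℝ) ≤ (Z : ℝ) ^ i / i.factorial := Nat.choose_le_pow_div i Z
          _ = ((Z : ℝ) / K) ^ i * ((K : ℝ) ^ i / i.factorial) := by
              rw [div_pow]; field_simp
          _ ≤ W ^ i * Real.exp K := by
              gcongr
              exact Real.pow_div_factorial_le_exp _ hK'.le i
    _ = _ := by
        rw [Finset.prod_mul_distrib, Finset.prod_pow_eq_pow_sum, Finset.prod_const,
          Finset.card_range, ← Real.exp_nat_mul]

theorem log_five_bounds : 1.609 < Real.log 5 ∧ Real.log 5 < 1.6174 := by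
  have h2 := Real.log_two_gt_d9
  have h2' := Real.log_two_lt_d9
  have h1 : 65 * Real.log 2 < 28 * Real.log 5 := by
    have : Real.log (2 ^ 65) < Real.log (5 ^ 28) :=
      Real.log_lt_log (by positivity) (by norm_num)
    simpa [Real.log_pow] using this
  have h3 : 3 * Real.log 5 < 7 * Real.log 2 := by
    have : Real.log (5 ^ 3) < Real.log (2 ^ 7) :=
      Real.log_lt_log (by positivity) (by norm_num)
    simpa [Real.log_pow] using this
  constructor <;> norm_num at * <;> linarith

theorem interpolation_log_inequality {p n K L S R y d e : ℕ} {W : ℝ} (hK0 : 0 < K) (hL0 : 0 < L)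
    (hy0 : 0 < y) (hp0 : 0 < p) (hy : y ^ p ≤ 5 ^ n) (hW1 : 1 ≤ W)
    (hW : (((R - 1) * p + (S - 1) * n : ℕ) : ℝ) / K ≤ W)
    (hE : 5 ^ (K * K * ∑ j ∈ Finset.range L, j) ≤ (K * L).factorial *
        (∏ i ∈ Finset.range K, ((R - 1) * p + (S - 1) * n).choose i) ^ L * 4 ^ d * y ^ e) :
    (K : ℝ) ^ 2 * L * ((L - 1) / 2) * Real.log 5 ≤ K * L * Real.log (K * L) +
      L * ((K : ℝ) ^ 2 / 2 * Real.log W + K ^ 2) + d * Real.log 4 + e * (n / p * Real.log 5) := by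
  set Z := (R - 1) * p + (S - 1) * n
  obtain ⟨Q, hQ⟩ : ∃ Q : ℝ, Q = K * L := ⟨_, rfl⟩
  have hQ0 : 0 < Q := by rw [hQ]; positivity
  have hW0 : 0 < W := by linarith
  have hyR : (0 : ℝ) < y := by exact_mod_cast hy0
  have hE' : (5 : ℝ) ^ (K * K * ∑ j ∈ Finset.range L, j) ≤ Q ^ (K * L) *
      (W ^ (∑ i ∈ Finset.range K, i) * Real.exp ((K : ℝ) * K)) ^ L * 4 ^ d * (y : ℝ) ^ e := by
    have h1 : (5 : ℝ) ^ (K * K * ∑ j ∈ Finset.range L, j) ≤ (K * L).factorial *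
        (∏ i ∈ Finset.range K, (Z.choose i : ℝ)) ^ L * 4 ^ d * (y : ℝ) ^ e := by
      exact_mod_cast hE
    rw [hQ]
    refine h1.trans ?_
    gcongr
    · exact_mod_cast Nat.factorial_le_pow (K * L)
    · exact prod_choose_le hK0 hW
  have hlog := Real.log_le_log (by positivity) hE'
  rw [Real.log_mul (by positivity) (by positivity), Real.log_mul (by positivity) (by positivity),
    Real.log_mul (by positivity) (by positivity), Real.log_pow, Real.log_pow, Real.log_pow,
    Real.log_pow, Real.log_pow, Real.log_mul (by positivity) (by positivity), Real.log_pow,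
    Real.log_exp] at hlog
  have hylog : Real.log y ≤ n / p * Real.log 5 := by
    have h1 : Real.log ((y : ℝ) ^ p) ≤ Real.log ((5 : ℝ) ^ n) :=
      Real.log_le_log (by positivity) (by exact_mod_cast hy)
    rw [Real.log_pow, Real.log_pow] at h1
    have hpR : (0 : ℝ) < p := by exact_mod_cast hp0
    rw [div_mul_eq_mul_div, le_div_iff₀ hpR]
    linarith
  have hsum : ∀ m : ℕ, ((∑ i ∈ Finset.range m, i : ℕ) : ℝ) = m * (m - 1) / 2 := by
    intro m
    induction m with
    | zero => simp
    | succ m ih => rw [Finset.sum_range_succ]; push_cast at ih ⊢; rw [ih]; ring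
  have hlogW : 0 ≤ Real.log W := Real.log_nonneg hW1
  have h2 : ((∑ i ∈ Finset.range K, i : ℕ) : ℝ) * Real.log W ≤ (K : ℝ) ^ 2 / 2 * Real.log W := by
    refine mul_le_mul_of_nonneg_right ?_ hlogW
    rw [hsum]
    nlinarith [(Nat.cast_nonneg K : (0 : ℝ) ≤ K)]
  rw [Nat.cast_mul, Nat.cast_mul, hsum L, Nat.cast_mul, hQ] at hlog
  have h3 : (e : ℝ) * Real.log y ≤ e * (n / p * Real.log 5) :=
    mul_le_mul_of_nonneg_left hylog (Nat.cast_nonneg e)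
  have h4 := mul_le_mul_of_nonneg_left h2 (Nat.cast_nonneg L : (0 : ℝ) ≤ L)
  nlinarith

theorem interpolation_parameter_estimates {ℓ k s r P x : ℝ} (hL : 13 ≤ ℓ) (hLp : ℓ ^ 4 ≤ 53 * P)
    (hpL : 53 * P < (ℓ + 1) ^ 4) (hn : 51 * P < 20 * x) (hnK : x < k * ℓ + ℓ)
    (hS : ℓ ^ 2 ≤ 9 * s) (hS' : 9 * s ≤ ℓ ^ 2 + 8) (hR : r * s ≤ ℓ * (k - 1) + s * ℓ)
    (hr0 : 0 ≤ r) :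
    104 ≤ k ∧ ℓ ≤ k ∧ 0 < s ∧ r * s ≤ 1.19 * (ℓ * k) ∧ x ≤ 1.01 * (k * ℓ) ∧
      s ≤ 0.11638 * ℓ ^ 2 ∧ ℓ * r ≤ 10.71 * k ∧ P ≤ 0.22843 * s * ℓ ^ 2 := by
  have hl0 : 0 < ℓ := by linarith
  have hℓ2 : 13 * ℓ ≤ ℓ ^ 2 := by rw [pow_two]; exact mul_le_mul_of_nonneg_right hL hl0.le
  have hℓ3 : 13 * ℓ ^ 2 ≤ ℓ ^ 3 := by
    rw [pow_succ' ℓ 2]; exact mul_le_mul_of_nonneg_right hL (sq_nonneg ℓ)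
  have hk1 : 51 * ℓ ^ 3 < 53 * 20 * (k + 1) := by
    refine lt_of_mul_lt_mul_right (a := ℓ) ?_ hl0.le
    rw [show 51 * ℓ ^ 3 * ℓ = 51 * ℓ ^ 4 by ring,
      show 53 * 20 * (k + 1) * ℓ = 53 * 20 * (k * ℓ + ℓ) by ring]
    linarith
  have hk2 : 104 ≤ k := by linarith
  have hs : s - 1 ≤ 0.19 * k := by norm_num; linarith
  have hrs : r * s ≤ 1.19 * (ℓ * k) := by
    have h1 := mul_le_mul_of_nonneg_left hs hl0.le
    norm_num at h1 ⊢
    linarith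
  refine ⟨hk2, by linarith, by linarith, hrs, ?_, by norm_num; linarith, ?_, ?_⟩
  · have h1 := mul_le_mul_of_nonneg_right hk2 hl0.le
    norm_num
    linarith
  · have h1 : r * ℓ ^ 2 ≤ r * (9 * s) := mul_le_mul_of_nonneg_left hS hr0
    have h2 : (ℓ * r) * ℓ ≤ (10.71 * k) * ℓ := by
      norm_num at hrs ⊢
      linarith
    exact le_of_mul_le_mul_right h2 hl0
  · have h1 : 13 * (ℓ + 1) ≤ 14 * ℓ := by linarith
    have h2 := pow_le_pow_left₀ (by linarith) h1 4
    rw [mul_pow, mul_pow] at h2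
    have h3 : ℓ ^ 2 * ℓ ^ 2 ≤ 9 * s * ℓ ^ 2 := mul_le_mul_of_nonneg_right hS (sq_nonneg ℓ)
    have h4 : ℓ ^ 4 ≤ 9 * s * ℓ ^ 2 := by linarith
    norm_num at h2 ⊢
    linarith

theorem interpolation_real_contradiction {ℓ k s r P x d e W : ℝ} (hL : 13 ≤ ℓ)
    (hLp : ℓ ^ 4 ≤ 53 * P) (hP0 : 0 < P) (hx0 : 0 ≤ x) (hk2 : 104 ≤ k) (hlk' : ℓ ≤ k)
    (hs0 : 0 < s) (hr0 : 0 ≤ r)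
    (hrs : r * s ≤ 1.19 * (ℓ * k)) (hx : x ≤ 1.01 * (k * ℓ)) (hsl : s ≤ 0.11638 * ℓ ^ 2)
    (hrl : ℓ * r ≤ 10.71 * k) (hd : 36 * d ^ 2 ≤ s * r ^ 3 * k * ℓ ^ 3)
    (he : 36 * e ^ 2 ≤ r * s ^ 3 * k * ℓ ^ 3) (hWdef : W = 0.4 * ℓ ^ 3)
    (hlog : k ^ 2 * ℓ * ((ℓ - 1) / 2) * Real.log 5 ≤ k * ℓ * Real.log (k * ℓ) +
      ℓ * (k ^ 2 / 2 * Real.log W + k ^ 2) + d * Real.log 4 + e * (x / P * Real.log 5)) :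
    False := by
  subst hWdef
  have hl0 : 0 < ℓ := by linarith
  have hk0 : 0 < k := by linarith
  have hroot : ∀ a b : ℝ, 0 ≤ b → 36 * a ^ 2 ≤ 1.19 * (k * ℓ ^ 2 * b) ^ 2 →
      6 * a ≤ 1.091 * (k * ℓ ^ 2 * b) := by
    intro a b hb hab
    refine abs_le_of_sq_le_sq' ?_ (by positivity) |>.2
    have h1 := sq_nonneg (k * ℓ ^ 2 * b)
    norm_num [mul_pow] at h1 hab ⊢
    linarith
  have hd' : 6 * d ≤ 1.091 * (k * ℓ ^ 2 * r) := by
    refine hroot _ _ hr0 (hd.trans ?_)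
    calc s * r ^ 3 * k * ℓ ^ 3 = (r * s) * (r ^ 2 * k * ℓ ^ 3) := by ring
      _ ≤ 1.19 * (ℓ * k) * (r ^ 2 * k * ℓ ^ 3) := mul_le_mul_of_nonneg_right hrs (by positivity)
      _ = _ := by ring
  have he' : 6 * e ≤ 1.091 * (k * ℓ ^ 2 * s) := by
    refine hroot _ _ hs0.le (he.trans ?_)
    calc r * s ^ 3 * k * ℓ ^ 3 = (r * s) * (s ^ 2 * k * ℓ ^ 3) := by ring
      _ ≤ 1.19 * (ℓ * k) * (s ^ 2 * k * ℓ ^ 3) := mul_le_mul_of_nonneg_right hrs (by positivity)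
      _ = _ := by ring
  have hd2 : d ≤ 1.9475 * (k ^ 2 * ℓ) := by
    have h1 : k * ℓ ^ 2 * r ≤ k * ℓ * (10.71 * k) := by
      calc k * ℓ ^ 2 * r = k * ℓ * (ℓ * r) := by ring
        _ ≤ _ := mul_le_mul_of_nonneg_left hrl (by positivity)
    have h2 : 0 ≤ k ^ 2 * ℓ := by positivity
    nlinarith
  have he2 : e * (x / P) ≤ 1.1328 * (k ^ 2 * ℓ) := by
    rw [← mul_div_assoc, div_le_iff₀ hP0]
    have h1 : 6 * e * x ≤ 1.091 * (k * ℓ ^ 2 * s) * x :=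
      mul_le_mul_of_nonneg_right he' hx0
    have h3 : s * x ≤ 0.11638 * ℓ ^ 2 * (1.01 * (k * ℓ)) :=
      mul_le_mul hsl hx hx0 (by positivity)
    have h4 : k * ℓ ^ 2 * (s * x) ≤ k * ℓ ^ 2 * (0.11638 * ℓ ^ 2 * (1.01 * (k * ℓ))) :=
      mul_le_mul_of_nonneg_left h3 (by positivity)
    have h5 : k ^ 2 * ℓ * ℓ ^ 4 ≤ k ^ 2 * ℓ * (53 * P) :=
      mul_le_mul_of_nonneg_left hLp (by positivity)
    have h6 : 0 ≤ k ^ 2 * ℓ * P := by positivity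
    nlinarith
  have hlk : Real.log (k * ℓ) ≤ 0.25 * k := by
    have h1 : Real.log k ≤ k / 8 := by
      have h := Real.log_le_sub_one_of_pos (show 0 < k / 2 ^ 6 by positivity)
      rw [Real.log_div hk0.ne' (by norm_num), Real.log_pow] at h
      have := Real.log_two_lt_d9
      norm_num at h
      linarith
    have h3 : Real.log ℓ ≤ Real.log k := Real.log_le_log (by linarith) hlk'
    rw [Real.log_mul hk0.ne' (by linarith)]
    linarith
  have hlW : Real.log (0.4 * ℓ ^ 3) ≤ 6.9315 + 3 * (ℓ / 13.679 - 1) := by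
    have hc : 0 < ℓ / 13.679 := by positivity
    have h1 : Real.log (0.4 * ℓ ^ 3) ≤ Real.log (2 ^ 10 * (ℓ / 13.679) ^ 3) := by
      refine Real.log_le_log (by positivity) ?_
      have := pow_pos hl0 3
      rw [div_pow]
      norm_num
      linarith
    rw [Real.log_mul (x := 2 ^ 10) (by norm_num) (by positivity), Real.log_pow,
      Real.log_pow (x := ℓ / 13.679)] at h1
    have h2 := Real.log_le_sub_one_of_pos hc
    have := Real.log_two_lt_d9
    norm_num at h1 h2 ⊢
    linarith
  obtain ⟨hlog5, hlog5'⟩ := log_five_bounds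
  have hlog4 : Real.log 4 ≤ 1.3863 := by
    have := Real.log_two_lt_d9
    rw [show (4 : ℝ) = 2 ^ 2 by norm_num, Real.log_pow]
    norm_num at this ⊢
    linarith
  have hlog4' : 0 ≤ Real.log 4 := Real.log_nonneg (by norm_num)
  have hM : 0 < k ^ 2 * ℓ := by positivity
  have t1 := mul_le_mul_of_nonneg_right hd2 hlog4'
  have t2 := mul_le_mul_of_nonneg_right he2 (show 0 ≤ Real.log 5 by linarith)
  have t3 := mul_le_mul_of_nonneg_left hlk (show 0 ≤ k * ℓ by positivity)
  have t4 : k ^ 2 * ℓ * ((ℓ - 1) / 2 * Real.log 5 - 0.25 - Real.log (0.4 * ℓ ^ 3) / 2 - 1 -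
      1.9475 * Real.log 4 - 1.1328 * Real.log 5) ≤ 0 := by
    linarith
  have t5 : 0 < (ℓ - 1) / 2 * Real.log 5 - 0.25 - Real.log (0.4 * ℓ ^ 3) / 2 - 1 -
      1.9475 * Real.log 4 - 1.1328 * Real.log 5 := by
    have : (ℓ - 1) / 2 * 1.609 ≤ (ℓ - 1) / 2 * Real.log 5 :=
      mul_le_mul_of_nonneg_left hlog5.le (by linarith)
    norm_num at *
    linarith
  nlinarith

theorem interpolation_parameters_contradiction {p n K L S R y d e : ℕ} (hL : 13 ≤ L)
    (hLp : L ^ 4 ≤ 53 * p) (hpL : 53 * p < (L + 1) ^ 4) (hn : 51 * p < 20 * n) (hy0 : 0 < y)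
    (hy : y ^ p ≤ 5 ^ n) (hKn : K * L ≤ n) (hnK : n < K * L + L) (hS : L ^ 2 ≤ 9 * S)
    (hS' : 9 * S ≤ L ^ 2 + 8) (hR : R * S ≤ L * (K - 1) + S * L)
    (hd : 36 * d ^ 2 ≤ S * R ^ 3 * K * L ^ 3) (he : 36 * e ^ 2 ≤ R * S ^ 3 * K * L ^ 3)
    (hE : 5 ^ (K * K * ∑ j ∈ Finset.range L, j) ≤ (K * L).factorial *
        (∏ i ∈ Finset.range K, ((R - 1) * p + (S - 1) * n).choose i) ^ L * 4 ^ d * y ^ e) :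
    False := by
  have hp0 : 0 < p := by
    rcases Nat.eq_zero_or_pos p with rfl | hp
    · have := Nat.pos_of_ne_zero (pow_ne_zero 4 (show L ≠ 0 by omega)); omega
    · exact hp
  have hr0 : (0 : ℝ) ≤ R := Nat.cast_nonneg R
  have hP0 : (0 : ℝ) < p := Nat.cast_pos.2 hp0
  have hK0 : 0 < K := by
    rcases Nat.eq_zero_or_pos K with rfl | hK
    · have h1 : 13 ^ 3 * L ≤ L ^ 3 * L := Nat.mul_le_mul_right L (Nat.pow_le_pow_left hL 3)
      have h2 : L ^ 4 = L ^ 3 * L := by ring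
      omega
    · exact hK
  have hk0 : (0 : ℝ) < K := Nat.cast_pos.2 hK0
  have hL' := hL
  rify [show 1 ≤ K from hK0] at hL hLp hpL hn hKn hnK hS hS' hR hd he
  obtain ⟨hk2, hlk, hs0, hrs, hx, hsl, hrl, hPs⟩ :=
    interpolation_parameter_estimates hL hLp hpL hn hnK hS hS' hR hr0
  have hW : (((R - 1) * p + (S - 1) * n : ℕ) : ℝ) / K ≤ 0.4 * (L : ℝ) ^ 3 := by
    rw [div_le_iff₀ hk0]
    have h1 : (((R - 1) * p + (S - 1) * n : ℕ) : ℝ) ≤ (R : ℝ) * p + S * n := by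
      have : (R - 1) * p + (S - 1) * n ≤ R * p + S * n := by gcongr <;> omega
      exact_mod_cast this
    have h2 : (R : ℝ) * p ≤ 0.22843 * (L : ℝ) ^ 2 * (1.19 * (L * K)) := by
      calc (R : ℝ) * p ≤ R * (0.22843 * S * (L : ℝ) ^ 2) := mul_le_mul_of_nonneg_left hPs hr0
        _ = 0.22843 * (L : ℝ) ^ 2 * (R * S) := by ring
        _ ≤ _ := mul_le_mul_of_nonneg_left hrs (by positivity)
    have h3 : (S : ℝ) * n ≤ 0.11638 * (L : ℝ) ^ 2 * (1.01 * (K * L)) :=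
      mul_le_mul hsl hx (Nat.cast_nonneg n) (by positivity)
    have h4 : 0 ≤ (K : ℝ) * (L : ℝ) ^ 3 := by positivity
    refine h1.trans ?_
    norm_num at h2 h3 h4 ⊢
    linarith
  have hW1 : (1 : ℝ) ≤ 0.4 * (L : ℝ) ^ 3 := by
    have h1 := pow_le_pow_left₀ (by norm_num) hL 3
    norm_num at h1 ⊢
    linarith
  have hlog := interpolation_log_inequality hK0 (by omega) hy0 hp0 hy hW1 hW hE
  exact interpolation_real_contradiction hL hLp hP0 (Nat.cast_nonneg n) hk2 hlk hs0 hr0 hrs hx hsl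
    hrl hd he rfl hlog

theorem no_solution_of_large_prime {p n y : ℕ} (hp : p.Prime) (hp541 : 541 ≤ p) (hodd : Odd n)
    (hn3 : 3 ≤ n) (h : y ^ p + 4 ^ n = 5 ^ n) : False := by
  have hpo : Odd p := hp.odd_of_ne_two (by omega)
  have hn := exponent_ratio hpo hodd hn3 h
  have hy5 := (root_residues hpo hodd hn3 h).2.1
  obtain ⟨L, hLdef⟩ : ∃ L, L = Nat.sqrt (Nat.sqrt (53 * p)) := ⟨_, rfl⟩
  have hLp : L ^ 4 ≤ 53 * p := by
    rw [show L ^ 4 = (L ^ 2) ^ 2 by ring]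
    exact (Nat.pow_le_pow_left (hLdef ▸ Nat.sqrt_le' _) 2).trans (Nat.sqrt_le' _)
  have hpL : 53 * p < (L + 1) ^ 4 := by
    rw [show (L + 1) ^ 4 = ((L + 1) ^ 2) ^ 2 by ring]
    exact (Nat.lt_succ_sqrt' _).trans_le
      (Nat.pow_le_pow_left (Nat.succ_le_of_lt (hLdef ▸ Nat.lt_succ_sqrt' _)) 2)
  have hL : 13 ≤ L := by
    by_contra hL
    have := Nat.pow_le_pow_left (show L + 1 ≤ 13 by omega) 4
    omega
  have hL2 : 169 ≤ L ^ 2 := Nat.pow_le_pow_left hL 2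
  have hL4 : 169 * L ^ 2 ≤ L ^ 4 := by
    rw [show L ^ 4 = L ^ 2 * L ^ 2 by ring]; exact Nat.mul_le_mul_right _ hL2
  obtain ⟨S, hSdef⟩ : ∃ S, S = (L ^ 2 + 8) / 9 := ⟨_, rfl⟩
  obtain ⟨K, hKdef⟩ : ∃ K, K = n / L := ⟨_, rfl⟩
  have hK1 : K * L ≤ n := hKdef ▸ Nat.div_mul_le_self n L
  have hK2 : n < K * L + L := by
    have := Nat.lt_div_mul_add (a := n) (show 0 < L by omega)
    rwa [← hKdef] at this
  obtain ⟨Q, hQdef⟩ : ∃ Q, Q = L * (K - 1) / S := ⟨_, rfl⟩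
  have hQ1 : Q * S ≤ L * (K - 1) := hQdef ▸ Nat.div_mul_le_self _ S
  have hQ2 : L * (K - 1) < Q * S + S := by
    have := Nat.lt_div_mul_add (a := L * (K - 1)) (show 0 < S by omega)
    rwa [← hQdef] at this
  obtain ⟨d, e, hd, he, hE⟩ := interpolation_inequality (R := Q + 1) hp (by omega)
    (not_dvd_exponent hp (by omega) hn3 h) hodd hy5 h hK1 (show S ≤ p by omega)
    (by rw [add_mul, one_mul]; exact hQ2)
  rw [show Q + 1 + L - 1 = Q + L by omega] at hd he hE
  exact interpolation_parameters_contradiction hL hLp hpL hn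
    (Nat.pos_of_ne_zero (by rintro rfl; simp at hy5)) (h ▸ Nat.le_add_right _ _) hK1 hK2
    (by omega) (by omega)
    (by rw [add_mul, mul_comm S L]; exact Nat.add_le_add_right hQ1 _) hd he hE

def boolSign (b : Bool) : ℤ := if b then -1 else 1

theorem boolSign_xor (a b : Bool) : boolSign (xor a b) = boolSign a * boolSign b := by
  cases a <;> cases b <;> rfl

def signedDiff (y i j : ℕ) : ℤ := (y : ℤ) ^ i - (-1) ^ i * 2 ^ j

theorem signedDiff_emod {y i j : ℕ} (hy : y % 8 = 5) (hj : 3 ≤ j) :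
    signedDiff y i j % 8 = if i % 2 = 1 then 5 else 1 := by
  obtain ⟨c, rfl⟩ := Nat.exists_eq_add_of_le hj
  have h1 : signedDiff y i (3 + c) ≡ 5 ^ i [ZMOD 8] := by
    have h2 : (y : ℤ) ^ i ≡ 5 ^ i [ZMOD 8] := Int.ModEq.pow i (by unfold Int.ModEq; omega)
    have h3 : (-1) ^ i * (2 : ℤ) ^ (3 + c) ≡ 0 [ZMOD 8] :=
      Int.modEq_zero_iff_dvd.2 (Dvd.intro_left ((-1) ^ i * 2 ^ c) (by ring))
    simpa [signedDiff] using h2.sub h3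
  have h5 : (5 ^ 2 : ℤ) ≡ 1 [ZMOD 8] := by decide
  rw [h1.eq]
  obtain ⟨b, rfl | rfl⟩ := Nat.even_or_odd' i
  · rw [pow_mul, (h5.pow b).eq]
    simp
  · rw [pow_succ, pow_mul, ((h5.pow b).mul_right 5).eq]
    simp [Nat.add_mod]

theorem natAbs_signedDiff_mod {y i j : ℕ} (hy : y % 8 = 5) (hj : 3 ≤ j)
    (h0 : 0 < signedDiff y i j) :
    (signedDiff y i j).natAbs % 8 = if i % 2 = 1 then 5 else 1 := by
  have := signedDiff_emod (i := i) hy hj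
  split_ifs at this ⊢ <;> omega

theorem jacobiSym_two_pow {y i j : ℕ} (hy : y % 8 = 5) (hj : 3 ≤ j)
    (h0 : 0 < signedDiff y i j) (l : ℕ) :
    jacobiSym (2 ^ l) (signedDiff y i j).natAbs = boolSign (i % 2 == 1 && l % 2 == 1) := by
  have h := natAbs_signedDiff_mod hy hj h0
  generalize (signedDiff y i j).natAbs = w at h
  have hodd : Odd w := Nat.odd_iff.2 (by split_ifs at h <;> omega)
  rw [jacobiSym.pow_left, jacobiSym.at_two hodd, ZMod.χ₈_nat_mod_eight, h]
  rcases Nat.mod_two_eq_zero_or_one i with hi | hi <;>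
  rcases Nat.even_or_odd l with hl | hl
  · simp [hi, boolSign, ZMod.χ₈]
  · simp [hi, boolSign, ZMod.χ₈]
  ·  simp [hi, Nat.even_iff.1 hl, boolSign, hl.neg_one_pow]
  ·  simp [hi, Nat.odd_iff.1 hl, boolSign, hl.neg_one_pow]

theorem jacobiSym_signedDiff_sub {y i j i' j' : ℕ} (hy : y % 8 = 5) (hj' : 3 ≤ j')
    (h0 : 0 < signedDiff y i' j') (hi : i' ≤ i) (hj : j' ≤ j) :
    jacobiSym (signedDiff y i j) (signedDiff y i' j').natAbs =
      boolSign (i' % 2 == 1 && j' % 2 == 1) *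
        jacobiSym (signedDiff y (i - i') (j - j')) (signedDiff y i' j').natAbs := by
  have h2 := jacobiSym_two_pow hy hj' h0 j'
  have h := natAbs_signedDiff_mod hy hj' h0
  obtain ⟨a, rfl⟩ := Nat.exists_eq_add_of_le hi
  obtain ⟨b, rfl⟩ := Nat.exists_eq_add_of_le hj
  have key : signedDiff y (i' + a) (j' + b) ≡ (-1) ^ i' * (2 ^ j' * signedDiff y a b)
      [ZMOD (signedDiff y i' j').natAbs] := by
    rw [Int.modEq_comm, Int.modEq_iff_dvd, Int.natCast_natAbs, abs_dvd]
    exact Dvd.intro ((y : ℤ) ^ a) (by unfold signedDiff; ring)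
  have h1 : jacobiSym ((-1) ^ i') (signedDiff y i' j').natAbs = 1 := by
    rw [jacobiSym.pow_left, jacobiSym.at_neg_one (Nat.odd_iff.2 (by split_ifs at h <;> omega)),
      ZMod.χ₄_nat_one_mod_four (by split_ifs at h <;> omega), one_pow]
  rw [jacobiSym.mod_left' key.eq, jacobiSym.mul_left, jacobiSym.mul_left, h1, h2,
    Nat.add_sub_cancel_left, Nat.add_sub_cancel_left, one_mul]

theorem jacobiSym_signedDiff_comm {y i j i' j' : ℕ} (hy : y % 8 = 5) (hj : 3 ≤ j) (hj' : 3 ≤ j')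
    (h0 : 0 < signedDiff y i j) (h0' : 0 < signedDiff y i' j') :
    jacobiSym (signedDiff y i j) (signedDiff y i' j').natAbs =
      jacobiSym (signedDiff y i' j') (signedDiff y i j).natAbs := by
  have h1 := natAbs_signedDiff_mod hy hj h0
  have h2 := natAbs_signedDiff_mod hy hj' h0'
  have h3 := jacobiSym.quadratic_reciprocity_one_mod_four (a := (signedDiff y i j).natAbs)
    (b := (signedDiff y i' j').natAbs) (by split_ifs at h1 <;> omega)
    (Nat.odd_iff.2 (by split_ifs at h2 <;> omega))
  rwa [Int.natCast_natAbs, Int.natCast_natAbs, abs_of_pos h0, abs_of_pos h0'] at h3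

/-- Exponent vectors on either side of the line `p j = 2 n i`. -/
structure ExponentPair (p n m i j i' j' t s : ℕ) : Prop where
  pos : 1 ≤ i
  pos' : 1 ≤ i'
  upper : p * j = 2 * n * i + m * t
  lower : p * j' + m * s = 2 * n * i'
  det : i * s + i' * t = p
  lt : i + i' < 2 * p

theorem ExponentPair.four_mul_le {p n m i j i' j' t s : ℕ} (H : ExponentPair p n m i j i' j' t s)
    (hmn : 5 * (p * m) ≤ 2 * n) (hp : 0 < p) : 4 * m ≤ j ∧ 4 * m ≤ j' := by
  have h1 : 2 * n * 1 ≤ 2 * n * i := Nat.mul_le_mul_left _ H.pos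
  have h2 : 2 * n * 1 ≤ 2 * n * i' := Nat.mul_le_mul_left _ H.pos'
  have h3 : 1 * s ≤ i * s := Nat.mul_le_mul_right _ H.pos
  have h4 : m * s ≤ m * p := Nat.mul_le_mul_left _ (by have := H.det; omega)
  have h5 := H.upper
  have h6 := H.lower
  have h7 : p * (4 * m) = 4 * (p * m) := by ring
  rw [mul_comm m p] at h4
  constructor <;> refine Nat.le_of_mul_le_mul_left ?_ hp <;> omega

theorem ExponentPair.pos_signedDiff {p n m i j i' j' t s y : ℕ}
    (H : ExponentPair p n m i j i' j' t s) (hy0 : 0 < y)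
    (hY : 16 ^ n * 2 ^ (p * m) < (y ^ p) ^ 2) :
    0 < signedDiff y i j ∧ 0 < signedDiff y i' j' := by
  have aux : ∀ i j t : ℕ, 1 ≤ i → t ≤ p → p * j ≤ 2 * n * i + m * t → 0 < signedDiff y i j := by
    intro i j t hi ht hj
    unfold signedDiff
    obtain ⟨c, rfl | rfl⟩ := Nat.even_or_odd' i
    · have h1 : (2 ^ j) ^ p < (y ^ (2 * c)) ^ p := by
        calc (2 ^ j) ^ p = 2 ^ (p * j) := by rw [← pow_mul, mul_comm]
          _ ≤ 2 ^ (2 * n * (2 * c) + m * t) := Nat.pow_le_pow_right (by norm_num) hj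
          _ ≤ 2 ^ (2 * n * (2 * c) + p * m * c) := by
              refine Nat.pow_le_pow_right (by norm_num) (Nat.add_le_add_left ?_ _)
              calc m * t ≤ m * p := Nat.mul_le_mul_left _ ht
                _ = p * m * 1 := by ring
                _ ≤ p * m * c := Nat.mul_le_mul_left _ (by omega)
          _ = (16 ^ n * 2 ^ (p * m)) ^ c := by
              rw [show 16 = 2 ^ 4 by norm_num, ← pow_mul, ← pow_add, ← pow_mul]
              congr 1; ring
          _ < ((y ^ p) ^ 2) ^ c := Nat.pow_lt_pow_left hY (by omega)
          _ = _ := by rw [← pow_mul, ← pow_mul, ← pow_mul]; congr 1; ring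
      have h2 : 2 ^ j < y ^ (2 * c) := lt_of_pow_lt_pow_left₀ p (Nat.zero_le _) h1
      have h3 : (2 : ℤ) ^ j < (y : ℤ) ^ (2 * c) := by exact_mod_cast h2
      simpa using h3
    · have : (0 : ℤ) < y := by exact_mod_cast hy0
      rw [pow_succ (-1 : ℤ), pow_mul]
      norm_num
      positivity
  have h1 := H.det
  have h2 : 1 * t ≤ i' * t := Nat.mul_le_mul_right _ H.pos'
  exact ⟨aux i j t H.pos (by omega) H.upper.le, aux i' j' 0 H.pos' (Nat.zero_le _)
    (by have := H.lower; omega)⟩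

/-- The Jacobi symbol sign attached to two exponent vectors of odd determinant. -/
def pairSign (i j i' : ℕ) : Bool := i % 2 == 1 && (j % 2 == 0 || i' % 2 == 0)

theorem pairSign_sub_left {i j i' j' : ℕ} (hi : i' ≤ i) (hj : j' ≤ j)
    (h : (i * j' + i' * j) % 2 = 1) :
    xor (i' % 2 == 1 && j' % 2 == 1) (pairSign (i - i') (j - j') i') = pairSign i j i' := by
  obtain ⟨a, rfl⟩ := Nat.exists_eq_add_of_le hi
  obtain ⟨b, rfl⟩ := Nat.exists_eq_add_of_le hj
  rw [Nat.add_sub_cancel_left, Nat.add_sub_cancel_left]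
  unfold pairSign
  rcases Nat.mod_two_eq_zero_or_one i' with h1 | h1 <;>
  rcases Nat.mod_two_eq_zero_or_one j' with h2 | h2 <;>
  rcases Nat.mod_two_eq_zero_or_one a with h3 | h3 <;>
  rcases Nat.mod_two_eq_zero_or_one b with h4 | h4 <;>
  simp [Nat.add_mod, Nat.mul_mod, h1, h2, h3, h4] at h ⊢

theorem pairSign_sub_right {i j i' j' : ℕ} (hi : i ≤ i') (hj : j ≤ j')
    (h : (i * j' + i' * j) % 2 = 1) :
    xor (i % 2 == 1 && j % 2 == 1) (pairSign i j (i' - i)) = pairSign i j i' := by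
  obtain ⟨a, rfl⟩ := Nat.exists_eq_add_of_le hi
  obtain ⟨b, rfl⟩ := Nat.exists_eq_add_of_le hj
  rw [Nat.add_sub_cancel_left]
  unfold pairSign
  rcases Nat.mod_two_eq_zero_or_one i with h1 | h1 <;>
  rcases Nat.mod_two_eq_zero_or_one j with h2 | h2 <;>
  rcases Nat.mod_two_eq_zero_or_one a with h3 | h3 <;>
  rcases Nat.mod_two_eq_zero_or_one b with h4 | h4 <;>
  simp [Nat.add_mod, Nat.mul_mod, h1, h2, h3, h4] at h ⊢

theorem ExponentPair.odd_det {p n m i j i' j' t s : ℕ} (H : ExponentPair p n m i j i' j' t s)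
    (hp : 0 < p) (hm : Odd m) : (i * j' + i' * j) % 2 = 1 := by
  have h1 : i' * j = i * j' + m := by
    refine Nat.eq_of_mul_eq_mul_left hp ?_
    have h2 := H.upper
    have h3 := H.lower
    have h4 := H.det
    zify at *
    linear_combination i' * h2 - i * h3 + m * h4
  rw [h1, ← add_assoc, ← two_mul, Nat.mul_add_mod, Nat.odd_iff.1 hm]

theorem jacobiSym_one_sub_five {p n m k e : ℕ} (hp : Odd p) (hm : Odd m) (hn : Odd n)
    (he : p * e + m = 2 * n * k) :
    jacobiSym (1 - (-1) ^ k * 2 ^ e) 5 = if p * m % 4 = 1 then -1 else 1 := by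
  have h2e : (2 : ℤ) ^ e ≡ 2 ^ (e % 4) [ZMOD (5 : ℕ)] := by
    conv_lhs => rw [← Nat.div_add_mod e 4, pow_add, pow_mul]
    have h1 : ((2 : ℤ) ^ 4) ^ (e / 4) ≡ 1 ^ (e / 4) [ZMOD (5 : ℕ)] :=
      Int.ModEq.pow _ (by decide)
    simpa using h1.mul_right (2 ^ (e % 4))
  have hk : ((-1 : ℤ)) ^ k = (-1) ^ (k % 2) := by rw [← neg_one_pow_eq_pow_mod_two]
  have hJ : 1 - (-1) ^ k * 2 ^ e ≡ 1 - (-1) ^ (k % 2) * 2 ^ (e % 4) [ZMOD (5 : ℕ)] := by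
    rw [hk]; exact (h2e.mul_left _).sub_left 1
  rw [jacobiSym.mod_left' hJ.eq]
  have h4 : (p % 4 * (e % 4) + m % 4) % 4 = 2 * (n % 2) * (k % 2) % 4 := by
    have : (p * e + m) % 4 = 2 * n * k % 4 := by rw [he]
    rw [Nat.add_mod, Nat.mul_mod] at this
    rw [Nat.add_mod, Nat.mod_mod, this, mul_assoc, mul_assoc, show 4 = 2 * 2 by norm_num,
      Nat.mul_mod_mul_left, Nat.mul_mod_mul_left, Nat.mul_mod]
  rw [Nat.mul_mod p m 4]
  have hp4 : p % 4 = 1 ∨ p % 4 = 3 := by have := Nat.odd_iff.1 hp; omega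
  have hm4 : m % 4 = 1 ∨ m % 4 = 3 := by have := Nat.odd_iff.1 hm; omega
  rw [Nat.odd_iff.1 hn] at h4
  have he4 := Nat.mod_lt e (show 4 > 0 by norm_num)
  generalize e % 4 = u at *
  rcases hp4 with h1 | h1 <;> rcases hm4 with h3 | h3 <;>
  rcases Nat.mod_two_eq_zero_or_one k with h2 | h2 <;>
  simp only [h1, h2, h3] at h4 ⊢ <;> interval_cases u <;> first | omega | norm_num

theorem jacobiSym_signedDiff {p n m y : ℕ} (hp : p.Prime) (hm : Odd m)
    (hmn : 5 * (p * m) ≤ 2 * n) (hy : y % 8 = 5) (hY : 16 ^ n * 2 ^ (p * m) < (y ^ p) ^ 2) :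
    ∀ f i j i' j' t s : ℕ, ExponentPair p n m i j i' j' t s → i + i' ≤ f →
      ∃ a, (2 ^ a) ^ p ≡ 4 ^ n [MOD 2 ^ m - 1] ∧
        jacobiSym (signedDiff y i j) (signedDiff y i' j').natAbs =
          boolSign (pairSign i j i') *
            jacobiSym (y + 2 ^ a) (2 ^ m - 1) := by
  intro f
  induction f with
  | zero => intro i j i' j' t s H hf; have := H.pos; omega
  | succ f ih =>
    intro i j i' j' t s H hf
    obtain ⟨hj, hj'⟩ := H.four_mul_le hmn hp.pos
    obtain ⟨h0, h0'⟩ := H.pos_signedDiff (by omega) hY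
    have hi0 := H.pos
    have hi0' := H.pos'
    have hlt := H.lt
    have hts : t + s ≤ p := by
      have := H.det
      have h1 : 1 * t ≤ i' * t := Nat.mul_le_mul_right _ hi0'
      have h2 : 1 * s ≤ i * s := Nat.mul_le_mul_right _ hi0
      omega
    have hmts : m * t + m * s ≤ p * m := by
      rw [← mul_add, mul_comm p]; exact Nat.mul_le_mul_left _ hts
    have hdet := H.odd_det hp.pos hm
    have hm1 : 1 ≤ m := hm.pos
    rcases lt_trichotomy i' i with hii | hii | hii
    · obtain ⟨c, rfl⟩ := Nat.exists_eq_add_of_lt hii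
      have hjj : j' ≤ j := by
        refine Nat.le_of_mul_le_mul_left ?_ hp.pos
        have := H.upper; have := H.lower
        have : 2 * n * i' ≤ 2 * n * (i' + c + 1) := Nat.mul_le_mul_left _ (by omega)
        omega
      have H' : ExponentPair p n m (i' + c + 1 - i') (j - j') i' j' (t + s) s := by
        refine ⟨by omega, hi0', ?_, H.lower, ?_, by omega⟩
        · have h1 := H.upper; have h2 := H.lower
          obtain ⟨l, rfl⟩ := Nat.exists_eq_add_of_le hjj
          rw [Nat.add_sub_cancel_left, show i' + c + 1 - i' = c + 1 by omega]
          linarith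
        · rw [show i' + c + 1 - i' = c + 1 by omega]
          linarith [H.det]
      obtain ⟨a, ha, hJ⟩ := ih _ _ _ _ _ _ H' (by omega)
      refine ⟨a, ha, ?_⟩
      rw [jacobiSym_signedDiff_sub hy (by omega) h0' hii.le hjj, hJ, ← mul_assoc, ← boolSign_xor,
        pairSign_sub_left hii.le hjj hdet]
    · subst hii
      have hts' : i' * (s + t) = p := by rw [mul_add]; exact H.det
      have hi1 : i' = 1 := by
        rcases (Nat.dvd_prime hp).1 (Dvd.intro _ hts') with h1 | h1 <;> omega
      subst hi1
      rw [one_mul] at hts'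
      have hjj : j = j' + m := by
        refine Nat.eq_of_mul_eq_mul_left hp.pos ?_
        have := H.upper; have := H.lower
        have : p * (j' + m) = p * j' + m * (s + t) := by rw [hts']; ring
        rw [mul_add m] at this
        omega
      have h2m : 1 ≤ 2 ^ m := Nat.one_le_two_pow
      have hM : 2 ^ m ≡ 1 [MOD 2 ^ m - 1] := ((Nat.modEq_iff_dvd' h2m).2 dvd_rfl).symm
      refine ⟨j', ?_, ?_⟩
      · have h1 := (hM.pow s).mul_left (2 ^ (p * j'))
        rw [← pow_mul, ← pow_add, H.lower, one_pow, mul_one, mul_one, pow_mul] at h1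
        rw [← pow_mul, mul_comm]
        exact h1.symm
      · have h8 := natAbs_signedDiff_mod hy (by omega) h0'
        have key : signedDiff y 1 j ≡ 2 ^ j' * ((2 ^ m - 1 : ℕ) : ℤ)
            [ZMOD (signedDiff y 1 j').natAbs] := by
          rw [Int.modEq_comm, Int.modEq_iff_dvd, Int.natCast_natAbs, abs_dvd, hjj]
          push_cast [h2m]
          exact Dvd.intro 1 (by unfold signedDiff; ring)
        have hc : signedDiff y 1 j' = y + 2 ^ j' := by unfold signedDiff; ring
        rw [jacobiSym.mod_left' key.eq, jacobiSym.mul_left, jacobiSym_two_pow hy (by omega) h0',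
          ← jacobiSym.quadratic_reciprocity_one_mod_four (by simp at h8; omega)
            (Nat.odd_iff.2 (by
              have : 2 ^ m = 2 * 2 ^ (m - 1) := by rw [← pow_succ']; congr 1; omega
              have := Nat.one_le_two_pow (n := m - 1)
              omega)), Int.natCast_natAbs, abs_of_pos h0', hc]
        have hps : pairSign 1 j 1 = (j' % 2 == 1) := by
          rcases Nat.mod_two_eq_zero_or_one j' with h1 | h1 <;>
          simp [pairSign, hjj, Nat.add_mod, Nat.odd_iff.1 hm, h1]
        simp [hps]
    · obtain ⟨c, rfl⟩ := Nat.exists_eq_add_of_lt hii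
      have hjj : j ≤ j' := by
        refine Nat.le_of_mul_le_mul_left ?_ hp.pos
        have := H.upper; have := H.lower
        have : 2 * n * (i + c + 1) = 2 * n * i + 2 * n * c + 2 * n := by ring
        omega
      have H' : ExponentPair p n m i j (i + c + 1 - i) (j' - j) t (s + t) := by
        refine ⟨hi0, by omega, H.upper, ?_, ?_, by omega⟩
        · have h1 := H.upper; have h2 := H.lower
          obtain ⟨l, rfl⟩ := Nat.exists_eq_add_of_le hjj
          rw [Nat.add_sub_cancel_left, show i + c + 1 - i = c + 1 by omega]
          linarith
        · rw [show i + c + 1 - i = c + 1 by omega]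
          linarith [H.det]
      obtain ⟨a, ha, hJ⟩ := ih _ _ _ _ _ _ H' (by omega)
      refine ⟨a, ha, ?_⟩
      obtain ⟨hl, hl'⟩ := H'.four_mul_le hmn hp.pos
      obtain ⟨hl0, hl0'⟩ := H'.pos_signedDiff (by omega) hY
      rw [jacobiSym_signedDiff_comm hy (by omega) (by omega) h0 h0',
        jacobiSym_signedDiff_sub hy (by omega) h0 hii.le hjj,
        jacobiSym_signedDiff_comm hy (by omega) (by omega) hl0' hl0, hJ,
        ← mul_assoc, ← boolSign_xor, pairSign_sub_right hii.le hjj hdet]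

theorem sixteen_pow_mul_lt {p n m y : ℕ} (hmp : 3 ≤ p * m) (hmn : 5 * (p * m) ≤ 2 * n)
    (h : y ^ p + 4 ^ n = 5 ^ n) : 16 ^ n * 2 ^ (p * m) < (y ^ p) ^ 2 := by
  generalize p * m = N at *
  have h1 (hmp : 4 ≤ N) : 4 * 2 ^ N < 3 ^ N := by
    induction N, hmp using Nat.le_induction with
    | base => norm_num
    | succ N hN ih =>
      have := ih (by omega) (by omega)
      rw [pow_succ, pow_succ]
      omega
  have h2 : 16 ^ n * 3 ^ N ≤ 25 ^ n := by
    obtain ⟨b, rfl | rfl⟩ : ∃ b, N = 2 * b ∨ N = 2 * b + 1 := Nat.even_or_odd' N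
    · obtain ⟨c, rfl⟩ := Nat.exists_eq_add_of_le (show 5 * b ≤ n by omega)
      rw [pow_add, pow_add, pow_mul, pow_mul, pow_mul]
      calc (16 ^ 5) ^ b * 16 ^ c * (3 ^ 2) ^ b = (16 ^ 5 * 3 ^ 2) ^ b * 16 ^ c := by
            rw [mul_pow]; ring
        _ ≤ (25 ^ 5) ^ b * 25 ^ c := by gcongr <;> norm_num
    · obtain ⟨c, rfl⟩ := Nat.exists_eq_add_of_le (show 5 * b + 3 ≤ n by omega)
      rw [pow_add, pow_add, pow_add, pow_add, pow_add, pow_mul, pow_mul, pow_mul]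
      calc (16 ^ 5) ^ b * 16 ^ 3 * 16 ^ c * ((3 ^ 2) ^ b * 3 ^ 1) =
            (16 ^ 5 * 3 ^ 2) ^ b * (16 ^ 3 * 3 ^ 1) * 16 ^ c := by rw [mul_pow]; ring
        _ ≤ (25 ^ 5) ^ b * 25 ^ 3 * 25 ^ c := by gcongr <;> norm_num
  have h3 : 0 < 16 ^ n := by positivity
  have h4 : 16 ^ n * (4 * 2 ^ N) < 25 ^ n := by
    rcases hmp.lt_or_eq with hN | rfl
    · exact (Nat.mul_lt_mul_of_pos_left (h1 hN) h3).trans_le h2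
    · obtain ⟨c, rfl⟩ := Nat.exists_eq_add_of_le (show 8 ≤ n by omega)
      rw [pow_add, pow_add]
      calc 16 ^ 8 * 16 ^ c * (4 * 2 ^ 3) = 16 ^ 8 * 32 * 16 ^ c := by ring
        _ < 25 ^ 8 * 16 ^ c := Nat.mul_lt_mul_of_pos_right (by norm_num) (by positivity)
        _ ≤ 25 ^ 8 * 25 ^ c := by gcongr; norm_num
  have e1 : 16 ^ n = (4 ^ n) ^ 2 := by rw [← pow_mul, mul_comm, pow_mul]; norm_num
  have e2 : 25 ^ n = (5 ^ n) ^ 2 := by rw [← pow_mul, mul_comm, pow_mul]; norm_num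
  have e3 : 1 ≤ 2 ^ N := Nat.one_le_two_pow
  rw [e1, e2] at h4
  rw [e1]
  generalize y ^ p = Y at *
  generalize 4 ^ n = A at *
  generalize 5 ^ n = B at *
  have h5 : 2 * A < B := by
    refine lt_of_pow_lt_pow_left₀ 2 (Nat.zero_le _) (lt_of_le_of_lt ?_ h4)
    nlinarith
  have h6 : B < 2 * Y := by omega
  nlinarith

theorem jacobiSym_residue_identity {p n m y : ℕ} (hp : p.Prime) (hp2 : Odd p)
    (hp3 : 3 ≤ p * m) (hodd : Odd n) (hn3 : 3 ≤ n) (hpn : ¬ p ∣ n) (h : y ^ p + 4 ^ n = 5 ^ n)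
    (hm : Odd m) (hpm : ¬ p ∣ m) (hmn : 5 * (p * m) ≤ 2 * n) :
    ∃ a, (2 ^ a) ^ p ≡ 4 ^ n [MOD 2 ^ m - 1] ∧
      jacobiSym (y + 2 ^ a) (2 ^ m - 1) = if p * m % 4 = 1 then 1 else -1 := by
  obtain ⟨k, e, hk, hkp, he⟩ : ∃ k e, 1 ≤ k ∧ k < p ∧ p * e + m = 2 * n * k := by
    have := Fact.mk hp
    have h2n : ((2 * n : ℕ) : ZMod p) ≠ 0 := by
      rwa [Ne, ZMod.natCast_eq_zero_iff, hp2.coprime_two_right.dvd_mul_left]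
    have hm0 : (m : ZMod p) ≠ 0 := by rwa [Ne, ZMod.natCast_eq_zero_iff]
    have hk := ZMod.natCast_zmod_val ((m : ZMod p) / ((2 * n : ℕ) : ZMod p))
    obtain ⟨k, hkdef⟩ : ∃ k, k = ((m : ZMod p) / ((2 * n : ℕ) : ZMod p)).val := ⟨_, rfl⟩
    rw [← hkdef] at hk
    have hk0 : 1 ≤ k := by
      rcases Nat.eq_zero_or_pos k with rfl | h0
      · rw [Nat.cast_zero] at hk
        exact absurd hk.symm (div_ne_zero hm0 h2n)
      · exact h0
    have hmod : m ≡ 2 * n * k [MOD p] := by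
      rw [← ZMod.natCast_eq_natCast_iff, Nat.cast_mul, hk, mul_div_cancel₀ _ h2n]
    have hle : m ≤ 2 * n * k := by
      have h1 : 1 * m ≤ p * m := Nat.mul_le_mul_right _ hp.one_le
      have h2 : 2 * n * 1 ≤ 2 * n * k := Nat.mul_le_mul_left _ hk0
      omega
    obtain ⟨e, he⟩ := (Nat.modEq_iff_dvd' hle).1 hmod
    exact ⟨k, e, hk0, hkdef ▸ ZMod.val_lt _, by omega⟩
  obtain ⟨hy8, hy5, -⟩ := root_residues hp2 hodd hn3 h
  have hY := sixteen_pow_mul_lt hp3 hmn h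
  have H : ExponentPair p n m p (2 * n) k e 0 1 :=
    ⟨hp.one_le, hk, by ring, by omega, by ring, by omega⟩
  obtain ⟨a, ha, hJ⟩ := jacobiSym_signedDiff hp hm hmn hy8 hY (p + k) _ _ _ _ _ _ H le_rfl
  obtain ⟨-, hl⟩ := H.four_mul_le hmn hp.pos
  have hm1 := hm.pos
  obtain ⟨-, h0⟩ := H.pos_signedDiff (by omega) hY
  refine ⟨a, ha, ?_⟩
  have h8 := natAbs_signedDiff_mod hy8 (by omega) h0
  have hx : signedDiff y p (2 * n) = ((5 : ℕ) : ℤ) ^ n := by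
    unfold signedDiff
    rw [hp2.neg_one_pow, pow_mul]
    have : (y : ℤ) ^ p + 4 ^ n = 5 ^ n := by exact_mod_cast h
    norm_num
    linarith
  have h5 : jacobiSym ((5 : ℕ) : ℤ) (signedDiff y k e).natAbs ^ n =
      jacobiSym ((5 : ℕ) : ℤ) (signedDiff y k e).natAbs := by
    obtain ⟨c, rfl⟩ := hodd
    rcases jacobiSym.trichotomy ((5 : ℕ) : ℤ) (signedDiff y k e).natAbs with h1 | h1 | h1 <;>
      rw [h1] <;> simp [pow_succ, pow_mul]
  have hy1 : (y : ℤ) ≡ 1 [ZMOD 5] := by unfold Int.ModEq; omega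
  have hmod : 1 - (-1) ^ k * 2 ^ e ≡ signedDiff y k e [ZMOD (5 : ℕ)] := by
    simpa [signedDiff] using ((hy1.symm.pow k).sub_right ((-1) ^ k * 2 ^ e))
  rw [hx, jacobiSym.pow_left, h5, jacobiSym.quadratic_reciprocity_one_mod_four (by norm_num)
    (Nat.odd_iff.2 (by split_ifs at h8 <;> omega)), Int.natCast_natAbs, abs_of_pos h0,
    ← jacobiSym.mod_left' hmod.eq,
    jacobiSym_one_sub_five hp2 hm hodd he] at hJ
  have hs : boolSign (pairSign p (2 * n) k) = -1 := by
    simp [pairSign, Nat.odd_iff.1 hp2, boolSign]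
  rw [hs] at hJ
  split_ifs at hJ ⊢ <;> linarith

theorem no_solution_of_three_mod_four {p n y : ℕ} (hp : p.Prime) (hp4 : p % 4 = 3) (hodd : Odd n)
    (hn3 : 3 ≤ n) (h : y ^ p + 4 ^ n = 5 ^ n) : False := by
  have hp2 : Odd p := Nat.odd_iff.2 (by omega)
  have hn := exponent_ratio hp2 hodd hn3 h
  obtain ⟨a, -, ha⟩ := jacobiSym_residue_identity (m := 1) hp hp2 (by omega) hodd hn3
    (not_dvd_exponent hp (by omega) hn3 h) h odd_one (by rw [Nat.dvd_one]; exact hp.ne_one)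
    (by omega)
  simp [hp4] at ha

/-- Trial division, valid below `512 ^ 2`. -/
def isSmallPrime (r : ℕ) : Bool :=
  2 ≤ r && r < 512 ^ 2 && (List.range 512).all fun d => d < 2 || r ≤ d || r % d != 0

theorem prime_of_isSmallPrime {r : ℕ} (h : isSmallPrime r = true) : r.Prime := by
  simp only [isSmallPrime, Bool.and_eq_true, decide_eq_true_eq, List.all_eq_true, List.mem_range,
    Bool.or_eq_true, bne_iff_ne] at h
  obtain ⟨⟨h2, hr⟩, hd⟩ := h
  by_contra hp
  have h1 := Nat.minFac_sq_le_self (by omega) hp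
  have h3 : r.minFac < 512 := lt_of_pow_lt_pow_left₀ 2 (by norm_num) (h1.trans_lt hr)
  have h4 := (Nat.minFac_prime (show r ≠ 1 by omega)).two_le
  rcases hd _ h3 with (h | h) | h
  · omega
  · nlinarith
  · exact h (Nat.mod_eq_zero_of_dvd r.minFac_dvd)

/-- The residue of `5 ^ n - 4 ^ n` modulo the prime `r`, given `n` modulo a multiple of `r - 1`. -/
def powDiffMod (r c : ℕ) : ℕ :=
  (5 ^ (c % (r - 1)) + (r - 4 ^ (c % (r - 1)) % r)) % r

theorem pow_mod_eq_pow {r M n b : ℕ} (hr : r.Prime) (hM : r - 1 ∣ M) (hb : ¬ r ∣ b) :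
    ((b ^ (n % M % (r - 1)) : ℕ) : ZMod r) = (b : ZMod r) ^ n := by
  have := Fact.mk hr
  rw [Nat.mod_mod_of_dvd _ hM]
  conv_rhs => rw [← Nat.div_add_mod n (r - 1), pow_add, pow_mul, ZMod.pow_card_sub_one_eq_one
    (by rwa [Ne, ZMod.natCast_eq_zero_iff]), one_pow, one_mul]
  push_cast
  rfl

theorem natCast_powDiffMod {r M n p y : ℕ} (hr : r.Prime) (hr5 : 5 < r) (hM : r - 1 ∣ M)
    (h : y ^ p + 4 ^ n = 5 ^ n) : (powDiffMod r (n % M) : ZMod r) = (y : ZMod r) ^ p := by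
  have h5 := pow_mod_eq_pow (n := n) hr hM (Nat.not_dvd_of_pos_of_lt (by norm_num) hr5)
  have h4 := pow_mod_eq_pow (n := n) hr hM
    (Nat.not_dvd_of_pos_of_lt (show 0 < 4 by norm_num) (by omega))
  have hy : (y : ZMod r) ^ p + ((4 : ℕ) : ZMod r) ^ n = ((5 : ℕ) : ZMod r) ^ n := by
    exact_mod_cast congrArg (Nat.cast : ℕ → ZMod r) h
  rw [powDiffMod, ZMod.natCast_mod, Nat.cast_add, Nat.cast_sub (Nat.mod_lt _ hr.pos).le,
    ZMod.natCast_mod, h5, h4, ← hy, ZMod.natCast_self]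
  ring

/-- Whether the class `c` of `n` is compatible with `5 ^ n - 4 ^ n` being a `p`-th power
modulo `r`. -/
def isPowerResidue (p r c : ℕ) : Bool :=
  powDiffMod r c == 0 || powDiffMod r c ^ ((r - 1) / p) % r == 1

theorem isPowerResidue_of_solution {r M n p y : ℕ} (hr : r.Prime) (hr5 : 5 < r) (hp : p ∣ r - 1)
    (hM : r - 1 ∣ M) (h : y ^ p + 4 ^ n = 5 ^ n) : isPowerResidue p r (n % M) = true := by
  have := Fact.mk hr
  have hd := natCast_powDiffMod hr hr5 hM h
  rw [isPowerResidue, Bool.or_eq_true, beq_iff_eq, beq_iff_eq]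
  have hp0 : p ≠ 0 := by rintro rfl; rw [zero_dvd_iff] at hp; omega
  by_cases hy : (y : ZMod r) = 0
  · rw [hy, zero_pow hp0, ZMod.natCast_eq_zero_iff] at hd
    exact Or.inl (Nat.eq_zero_of_dvd_of_lt hd (Nat.mod_lt _ hr.pos))
  · right
    suffices powDiffMod r (n % M) ^ ((r - 1) / p) ≡ 1 [MOD r] by
      rwa [Nat.ModEq, Nat.mod_eq_of_lt hr.one_lt] at this
    rw [← ZMod.natCast_eq_natCast_iff, Nat.cast_pow, hd, ← pow_mul, Nat.mul_div_cancel' hp,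
      ZMod.pow_card_sub_one_eq_one hy, Nat.cast_one]

/-- Depth-first refinement of the class `c` of `n` modulo `M`: each `(r, t)` refines the modulus
to `M * t`, keeps the classes that pass the test modulo `r`, and `final` must hold at the leaves. -/
def sieve (p : ℕ) (final : ℕ → ℕ → Bool) : List (ℕ × ℕ) → ℕ → ℕ → Bool
  | [], M, c => final M c
  | (r, t) :: l, M, c =>
    0 < t && isSmallPrime r && 5 < r && (r - 1) % p == 0 && M * t % (r - 1) == 0 &&
      (List.range t).all fun i =>
        !isPowerResidue p r (c + M * i) || sieve p final l (M * t) (c + M * i)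

theorem exists_final_of_sieve {p n y : ℕ} {final : ℕ → ℕ → Bool}
    (h : y ^ p + 4 ^ n = 5 ^ n) :
    ∀ (l : List (ℕ × ℕ)) (M : ℕ), sieve p final l M (n % M) = true →
      ∃ M', final M' (n % M') = true
  | [], M, hs => ⟨M, hs⟩
  | (r, t) :: l, M, hs => by
    simp only [sieve, Bool.and_eq_true, decide_eq_true_eq, beq_iff_eq, List.all_eq_true,
      List.mem_range, Bool.or_eq_true, Bool.not_eq_true'] at hs
    obtain ⟨⟨⟨⟨⟨ht, hr⟩, hr5⟩, hp⟩, hM⟩, hs⟩ := hs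
    have h1 := hs _ (Nat.mod_lt (n / M) ht)
    rw [← Nat.mod_mul, isPowerResidue_of_solution (prime_of_isSmallPrime hr) hr5
      (Nat.dvd_of_mod_eq_zero hp) (Nat.dvd_of_mod_eq_zero hM) h] at h1
    exact exists_final_of_sieve h l _ (h1.resolve_left (by decide))

/-- The Legendre symbol by Euler's criterion. -/
def eulerSym (q z : ℕ) : ℤ :=
  if z ^ (q / 2) % q = 0 then 0 else if z ^ (q / 2) % q = 1 then 1 else -1

theorem eulerSym_eq_jacobiSym {q : ℕ} (hq : q.Prime) (hq2 : 2 < q) (z : ℕ) :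
    eulerSym q z = jacobiSym z q := by
  have := Fact.mk hq
  rw [← jacobiSym.legendreSym.to_jacobiSym]
  have h := legendreSym.eq_pow q z
  have h0 : z ^ (q / 2) % q = 0 ↔ ((z : ℤ) : ZMod q) ^ (q / 2) = 0 := by
    rw [← Nat.dvd_iff_mod_eq_zero, ← ZMod.natCast_eq_zero_iff]
    push_cast
    rfl
  have h1 : z ^ (q / 2) % q = 1 ↔ ((z : ℤ) : ZMod q) ^ (q / 2) = 1 := by
    have e : z ^ (q / 2) % q = 1 ↔ z ^ (q / 2) ≡ 1 [MOD q] := by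
      rw [Nat.ModEq, Nat.mod_eq_of_lt hq.one_lt]
    rw [e, ← ZMod.natCast_eq_natCast_iff]
    push_cast
    rfl
  have : Fact (2 < q) := ⟨hq2⟩
  rw [eulerSym]
  simp only [h0, h1, ← h]
  rcases (jacobiSym.legendreSym.to_jacobiSym q z ▸ jacobiSym.trichotomy (z : ℤ) q :
    legendreSym q z = 0 ∨ legendreSym q z = 1 ∨ legendreSym q z = -1) with hl | hl | hl <;>
  simp [hl, ZMod.neg_one_ne_one]

theorem natCast_pow_inverse {q p p' : ℕ} (hq : q.Prime) (hpp : p * p' % (q - 1) = 1)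
    (x : ZMod q) : (x ^ p) ^ p' = x := by
  have := Fact.mk hq
  rw [← pow_mul]
  by_cases hx : x = 0
  · rw [hx, zero_pow]
    intro h0
    rw [h0] at hpp
    simp at hpp
  · conv_lhs => rw [← Nat.div_add_mod (p * p') (q - 1), hpp, pow_add, pow_mul,
      ZMod.pow_card_sub_one_eq_one hx, one_pow, one_mul, pow_one]

/-- A residue of `y + 2 ^ a` modulo `q`, given the class `c` of `n`, when `y ^ p = 5 ^ n - 4 ^ n`
and `(2 ^ a) ^ p = 4 ^ n`, and `p'` inverts `p` modulo `q - 1`. -/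
def rootSum (c q p' : ℕ) : ℕ :=
  powDiffMod q c ^ p' + (4 ^ (c % (q - 1)) % q) ^ p'

theorem eulerSym_rootSum {q p p' n M y a : ℕ} (hq : q.Prime) (hq5 : 5 < q)
    (hpp : p * p' % (q - 1) = 1) (hM : q - 1 ∣ M) (h : y ^ p + 4 ^ n = 5 ^ n)
    (ha : (2 ^ a) ^ p ≡ 4 ^ n [MOD q]) :
    eulerSym q (rootSum (n % M) q p') = jacobiSym (y + 2 ^ a) q := by
  rw [eulerSym_eq_jacobiSym hq (by omega)]
  refine jacobiSym.mod_left' ?_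
  change _ ≡ _ [ZMOD _]
  have h4 := pow_mod_eq_pow (n := n) hq hM
    (Nat.not_dvd_of_pos_of_lt (show 0 < 4 by norm_num) (by omega))
  have ha' : ((2 : ZMod q) ^ a) ^ p = ((4 : ℕ) : ZMod q) ^ n := by
    have := (ZMod.natCast_eq_natCast_iff _ _ _).2 ha
    push_cast at this ⊢
    exact this
  rw [← ZMod.intCast_eq_intCast_iff, rootSum]
  push_cast
  rw [natCast_powDiffMod hq hq5 hM h, natCast_pow_inverse hq hpp]
  congr 1
  rw [← natCast_pow_inverse hq hpp (2 ^ a), ha', ← h4]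
  simp

/-- Whether the class `c` of `n` modulo `M` contradicts `jacobiSym_residue_identity` for the
modulus `2 ^ m - 1`; the list `qs` pairs the prime factors of `2 ^ m - 1` with inverses of `p`. -/
def isExcluded (p m : ℕ) (qs : List (ℕ × ℕ)) (M c : ℕ) : Bool :=
  (5 * (p * m) ≤ 2 * c || (20 * c ≤ 51 * p && 5 * (p * m) ≤ 2 * (c + M))) &&
    (qs.all fun q => isSmallPrime q.1 && 5 < q.1 && p * q.2 % (q.1 - 1) == 1 &&
      M % (q.1 - 1) == 0) &&
    (qs.map fun q => eulerSym q.1 (rootSum c q.1 q.2)).prod != if p * m % 4 = 1 then 1 else -1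

def excludesExponent (p m : ℕ) (qs rs : List (ℕ × ℕ)) : Bool :=
  p % 2 == 1 && 3 ≤ p * m && m % 2 == 1 && m % p != 0 && (qs.map Prod.fst).prod == 2 ^ m - 1 &&
    (List.range p).all fun i =>
      (2 * i + 1) % p == 0 || sieve p (isExcluded p m qs) rs (2 * p) (2 * i + 1)

theorem no_solution_of_excludesExponent {p m n y : ℕ} {qs rs : List (ℕ × ℕ)}
    (hs : excludesExponent p m qs rs = true) (hp : p.Prime) (hodd : Odd n) (hn3 : 3 ≤ n)
    (h : y ^ p + 4 ^ n = 5 ^ n) : False := by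
  simp only [excludesExponent, Bool.and_eq_true, decide_eq_true_eq, beq_iff_eq, bne_iff_ne,
    List.all_eq_true, List.mem_range, Bool.or_eq_true] at hs
  obtain ⟨⟨⟨⟨⟨hp2, hp3⟩, hm⟩, hpm⟩, hprod⟩, hs⟩ := hs
  rw [← Nat.odd_iff] at hp2 hm
  have hpn := not_dvd_exponent hp (by rintro rfl; exact absurd hp2 (by decide)) hn3 h
  have hc : 2 * (n % (2 * p) / 2) + 1 = n % (2 * p) := by
    have h1 : n % (2 * p) % 2 = n % 2 := Nat.mod_mod_of_dvd _ (Dvd.intro _ rfl)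
    have := Nat.odd_iff.1 hodd
    omega
  have hsi := hs (n % (2 * p) / 2) (by
    have := Nat.mod_lt n (show 2 * p > 0 by have := hp.pos; omega)
    omega)
  rw [hc, Nat.mod_mod_of_dvd _ (Dvd.intro_left _ rfl)] at hsi
  obtain ⟨M, hM⟩ := exists_final_of_sieve h _ _
    (hsi.resolve_left fun h0 => hpn (Nat.dvd_of_mod_eq_zero h0))
  simp only [isExcluded, Bool.and_eq_true, decide_eq_true_eq, beq_iff_eq, bne_iff_ne,
    List.all_eq_true, Bool.or_eq_true] at hM
  obtain ⟨⟨hbound, hqs⟩, hne⟩ := hM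
  have hratio := exponent_ratio hp2 hodd hn3 h
  have hmn : 5 * (p * m) ≤ 2 * n := by
    have h1 := Nat.mod_add_div n M
    rcases hbound with hb | ⟨hb, hb'⟩
    · omega
    · rcases Nat.eq_zero_or_pos (n / M) with h0 | h0
      · rw [h0] at h1; omega
      · have := Nat.mul_le_mul_left M h0; omega
  obtain ⟨a, ha, hJ⟩ := jacobiSym_residue_identity hp hp2 hp3 hodd hn3 hpn h hm
    (fun hd => hpm (Nat.mod_eq_zero_of_dvd hd)) hmn
  have hdvd : ∀ q ∈ qs, (2 ^ a) ^ p ≡ 4 ^ n [MOD q.1] := fun q hq =>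
    ha.of_dvd (hprod ▸ List.dvd_prod (List.mem_map_of_mem hq))
  refine hne ?_
  rw [← hJ, ← hprod, jacobiSym.list_prod_right, List.map_map]
  · refine congrArg List.prod (List.map_congr_left fun q hq => ?_)
    obtain ⟨⟨⟨hq', hq5⟩, hpp⟩, hqM⟩ := hqs q hq
    exact eulerSym_rootSum (prime_of_isSmallPrime hq') hq5 hpp (Nat.dvd_of_mod_eq_zero hqM) h
      (hdvd q hq)
  · intro q' hq'
    obtain ⟨q, hq, rfl⟩ := List.mem_map.1 hq'
    have := (hqs q hq).1.1.2
    omega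

/-- Parameters `(p, m, qs, rs)` for `excludesExponent`. -/
def exclusionCertificates : List (ℕ × ℕ × List (ℕ × ℕ) × List (ℕ × ℕ)) := [
  (13, 5, [(31, 7)], [(53, 2), (79, 3), (131, 5), (157, 1)]),
  (17, 7, [(127, 89)], [(103, 3), (137, 4), (239, 7), (307, 3), (409, 1)]),
  (29, 9, [(7, 5), (73, 5)], [(59, 1), (233, 4), (523, 9)]),
  (37, 5, [(31, 13)], [(149, 2), (223, 3), (1481, 10)]),
  (41, 11, [(23, 7), (89, 73)], [(83, 1), (739, 9), (2953, 4), (5413, 11)]),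
  (53, 5, [(31, 17)], [(107, 1), (1061, 10), (3181, 3)]),
  (61, 9, [(7, 1), (73, 13)], [(367, 3), (733, 2), (13177, 18)]),
  (73, 11, [(23, 19), (89, 41)], [(293, 2), (439, 3), (1607, 11), (1753, 2)]),
  (89, 25, [(31, 29), (601, 209), (1801, 809)],
    [(179, 1), (1069, 6), (2137, 2), (4451, 25), (8011, 3), (26701, 1)]),
  (97, 5, [(31, 13)], [(389, 2), (971, 5), (5821, 3)]),
  (101, 7, [(127, 5)], [(607, 3), (1213, 2), (3637, 3), (4243, 7)]),
  (109, 7, [(127, 37)], [(1091, 5), (3271, 3), (9157, 14), (9811, 3)]),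
  (113, 5, [(31, 17)], [(227, 1), (3391, 15)]),
  (137, 9, [(7, 5), (73, 41)], [(823, 3), (1097, 4), (2467, 3)]),
  (149, 13, [(8191, 1649)], [(2087, 7), (2683, 9), (13411, 5), (58111, 13), (93871, 1)]),
  (157, 5, [(31, 13)], [(1571, 5), (5653, 18)]),
  (173, 5, [(31, 17)], [(347, 1), (1039, 3), (3461, 10)]),
  (181, 25, [(31, 1), (601, 421), (1801, 1621)],
    [(1087, 3), (1811, 5), (3259, 3), (13033, 4), (162901, 5)]),
  (193, 5, [(31, 7)], [(773, 2), (1931, 5), (6949, 9)]),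
  (197, 5, [(31, 23)], [(3547, 9), (11821, 10)]),
  (229, 15, [(7, 1), (31, 19), (151, 19)], [(2749, 6), (6871, 5), (22901, 5)]),
  (233, 5, [(31, 17)], [(467, 1), (1399, 3), (6991, 5)]),
  (241, 7, [(127, 103)], [(1447, 3), (2411, 5), (4339, 3), (16871, 7)]),
  (257, 5, [(31, 23)], [(1543, 3), (23131, 15)]),
  (269, 7, [(127, 89)], [(3767, 7), (11299, 3), (169471, 15)]),
  (277, 5, [(31, 13)], [(1663, 3), (8311, 5)]),
  (281, 15, [(7, 5), (31, 11), (151, 71)], [(563, 1), (8431, 15), (14051, 5)]),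
  (293, 5, [(31, 17)], [(587, 1), (1759, 3), (3517, 2), (5861, 5)]),
  (313, 5, [(31, 7)], [(1879, 3), (9391, 5), (37561, 4)]),
  (317, 5, [(31, 23)], [(9511, 15), (15217, 8)]),
  (337, 5, [(31, 13)], [(3371, 5), (6067, 9)]),
  (349, 11, [(23, 7), (89, 29)], [(3491, 5), (30713, 44)]),
  (353, 7, [(127, 5)], [(4943, 7), (14827, 3), (31771, 15)]),
  (373, 5, [(31, 7)], [(1493, 2), (2239, 3), (22381, 5)]),
  (389, 11, [(23, 3), (89, 69)], [(9337, 12), (17117, 11)]),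
  (397, 5, [(31, 13)], [(2383, 3), (15881, 20)]),
  (401, 15, [(7, 5), (31, 11), (151, 101)], [(4813, 6), (20051, 25), (24061, 1)]),
  (409, 7, [(127, 61)], [(1637, 2), (4909, 3), (9817, 2), (68713, 7), (103069, 3)]),
  (421, 9, [(7, 1), (73, 13)], [(4211, 5), (6737, 8), (30313, 9)]),
  (433, 5, [(31, 7)], [(1733, 2), (5197, 3), (17321, 10)]),
  (449, 13, [(8191, 6749)],
    [(6287, 7), (18859, 3), (35023, 13), (37717, 2), (62861, 5), (113149, 3)]),
  (457, 5, [(31, 13)], [(13711, 15), (16453, 6)]),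
  (461, 9, [(7, 5), (73, 5)], [(2767, 3), (9221, 10), (22129, 4), (41491, 3)]),
  (509, 11, [(23, 15), (89, 37)], [(1019, 1), (4073, 4), (22397, 11)]),
  (521, 7, [(127, 89)], [(18757, 18), (65647, 7)])]

theorem excludesExponent_of_mem_certificates :
    ∀ c ∈ exclusionCertificates, excludesExponent c.1 c.2.1 c.2.2.1 c.2.2.2 = true := by
  decide +kernel

theorem exists_certificate : ∀ p ∈ List.range 541,
    1 < p ∧ p % 4 = 1 ∧ p ≠ 5 →
      p ∈ exclusionCertificates.map Prod.fst ∨ ∃ d ∈ List.range p, 1 < d ∧ d ∣ p := by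
  decide +kernel

theorem no_solution_of_small_prime {p n y : ℕ} (hp : p.Prime) (hp541 : p < 541) (hp4 : p % 4 = 1)
    (hp5 : p ≠ 5) (hodd : Odd n) (hn3 : 3 ≤ n) (h : y ^ p + 4 ^ n = 5 ^ n) : False := by
  rcases exists_certificate p (List.mem_range.2 hp541) ⟨hp.one_lt, hp4, hp5⟩ with
    hp' | ⟨d, hdp, hd1, hd⟩
  · obtain ⟨c, hc, rfl⟩ := List.mem_map.1 hp'
    exact no_solution_of_excludesExponent (excludesExponent_of_mem_certificates c hc) hp hodd hn3 h
  · rw [List.mem_range] at hdp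
    rcases (Nat.dvd_prime hp).1 hd with h1 | h1 <;> omega

theorem no_solution_of_odd_exponent {p : ℕ} (hp : p.Prime) (hp2 : p ≠ 2) (n y : ℕ) (hodd : Odd n)
    (hn3 : 3 ≤ n) : y ^ p + 4 ^ n ≠ 5 ^ n := by
  intro h
  have hp' := Nat.odd_iff.1 (hp.odd_of_ne_two hp2)
  rcases (by omega : p % 4 = 3 ∨ p % 4 = 1) with hp4 | hp4
  · exact no_solution_of_three_mod_four hp hp4 hodd hn3 h
  · rcases eq_or_ne p 5 with rfl | hp5
    · exact no_solution_of_exponent_five hn3 (not_dvd_exponent hp hp2 hn3 h) h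
    · rcases lt_or_ge p 541 with hlt | hge
      · exact no_solution_of_small_prime hp hlt hp4 hp5 hodd hn3 h
      · exact no_solution_of_large_prime hp hge hodd hn3 h

/-- If `5 ^ n - 4 ^ n = m ^ k` with `n, m, k ≥ 2`, then `n = 2`: the number `9` is the
only perfect power of the form `5 ^ n - 4 ^ n` with `n ≥ 2`. -/
theorem five_pow_sub_four_pow_perfect_power (n m k : ℕ)
    (hn : 2 ≤ n) (hm : 2 ≤ m) (hk : 2 ≤ k)
    (h : (5 : ℤ) ^ n - 4 ^ n = (m : ℤ) ^ k) : n = 2 := by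
  have h' : m ^ k + 4 ^ n = 5 ^ n := by
    zify
    linarith
  rcases Nat.even_or_odd k with ⟨c, rfl⟩ | hk2
  · exact square_case hn (y := m ^ c) (by rw [← h', ← pow_mul, mul_two])
  · obtain ⟨p, hp, c, rfl⟩ := Nat.exists_prime_and_dvd (show k ≠ 1 by omega)
    have hp2 : p ≠ 2 := by
      rintro rfl
      exact absurd hk2 (by simp)
    rw [mul_comm, pow_mul] at h'
    exact absurd h' (odd_exponent_of_descent hp hp2 (no_solution_of_odd_exponent hp hp2) n _ hn)
end

section
/- Let b, c be nonzero integers with b^2 + 4c = 1. Then for every n ≥ 1, the three integers u_n, v_n, and c are pairwise relatively prime: gcd(u_n, v_n) = 1, gcd(u_n, c) = 1, and gcd(v_n, c) = 1. -/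
/-- The Lucas sequence associated to `(b, c)`:
`u 0 = 0`, `u 1 = 1`, `u (n+2) = b * u (n+1) + c * u n`. -/
def lucasU (b c : ℤ) : ℕ → ℤ
  | 0 => 0
  | 1 => 1
  | n + 2 => b * lucasU b c (n + 1) + c * lucasU b c n

/-- The companion Lucas sequence associated to `(b, c)`:
`v 0 = 2`, `v 1 = b`, `v (n+2) = b * v (n+1) + c * v n`. -/
def lucasV (b c : ℤ) : ℕ → ℤ
  | 0 => 2
  | 1 => b
  | n + 2 => b * lucasV b c (n + 1) + c * lucasV b c n

/-- Binet's formula for `lucasU` when the roots `k + 1` and `k` differ by one. -/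
theorem lucasU_eq_pow_sub_pow (k : ℤ) (n : ℕ) :
    lucasU (2 * k + 1) (-(k * (k + 1))) n = (k + 1) ^ n - k ^ n := by
  induction n using Nat.twoStepInduction with
  | zero => simp [lucasU]
  | one => simp [lucasU]
  | more n h₀ h₁ => rw [lucasU, h₀, h₁]; ring

/-- Binet's formula for `lucasV` when the roots `k + 1` and `k` differ by one. -/
theorem lucasV_eq_pow_add_pow (k : ℤ) (n : ℕ) :
    lucasV (2 * k + 1) (-(k * (k + 1))) n = (k + 1) ^ n + k ^ n := by
  induction n using Nat.twoStepInduction with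
  | zero => simp [lucasV]
  | one => simp [lucasV]; ring
  | more n h₀ h₁ => rw [lucasV, h₀, h₁]; ring

theorem IsCoprime.pow_add_pow_mul {R : Type*} [CommRing R] {x y : R} (h : IsCoprime x y)
    {n : ℕ} (hn : n ≠ 0) : IsCoprime (x ^ n + y ^ n) (x * y) := by
  obtain ⟨m, rfl⟩ := Nat.exists_eq_add_one_of_ne_zero hn
  refine IsCoprime.mul_right ?_ ?_
  · have := (h.symm.pow_left (m := m + 1)).add_mul_left_left (x ^ m)
    convert this using 1
    ring
  · have := (h.pow_left (m := m + 1)).add_mul_left_left (y ^ m)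
    convert this using 1
    ring

theorem IsCoprime.pow_sub_pow_mul {R : Type*} [CommRing R] {x y : R} (h : IsCoprime x y)
    {n : ℕ} (hn : n ≠ 0) : IsCoprime (x ^ n - y ^ n) (x * y) := by
  obtain ⟨m, rfl⟩ := Nat.exists_eq_add_one_of_ne_zero hn
  refine IsCoprime.mul_right ?_ ?_
  · have := (h.symm.pow_left (m := m + 1)).neg_left.add_mul_left_left (x ^ m)
    convert this using 1
    ring
  · have := (h.pow_left (m := m + 1)).add_mul_left_left (-y ^ m)
    convert this using 1
    ring

/-- If `b² + 4c = 1`, then for every `n ≥ 1`, the integers `u n`, `v n`, and `c` are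
pairwise relatively prime. -/
theorem lucas_pairwise_coprime (b c : ℤ) (hb : b ≠ 0) (hc : c ≠ 0)
    (h1 : b ^ 2 + 4 * c = 1) (n : ℕ) (hn : 1 ≤ n) :
    IsCoprime (lucasU b c n) (lucasV b c n) ∧
    IsCoprime (lucasU b c n) c ∧
    IsCoprime (lucasV b c n) c := by
  obtain ⟨k, rfl⟩ : Odd b := by
    have : Odd (b ^ 2) := ⟨-2 * c, by linarith⟩
    exact (Int.odd_pow' two_ne_zero).mp this
  obtain rfl : c = -(k * (k + 1)) := by linarith
  rw [lucasU_eq_pow_sub_pow, lucasV_eq_pow_add_pow, mul_comm k]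
  have hk : IsCoprime (k + 1) k := ⟨1, -1, by ring⟩
  have hn₀ : n ≠ 0 := by lia
  have hu := hk.pow_sub_pow_mul hn₀
  refine ⟨?_, hu.neg_right, (hk.pow_add_pow_mul hn₀).neg_right⟩
  have hu_two : IsCoprime ((k + 1) ^ n - k ^ n) 2 :=
    hu.of_isCoprime_of_dvd_right (mul_comm k (k + 1) ▸ (Int.even_mul_succ_self k).two_dvd)
  have hu_pow : IsCoprime ((k + 1) ^ n - k ^ n) (k ^ n) := hu.of_mul_right_right.pow_right
  have h_sum : (k + 1) ^ n + k ^ n = 2 * k ^ n + ((k + 1) ^ n - k ^ n) * 1 := by ring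
  rw [h_sum]
  exact (hu_two.mul_right hu_pow).add_mul_left_right 1
end

section
/- Let b ≥ 1 and c be nonzero integers with b^2 + 4c = 1, and suppose the set of primes dividing c is one of {2}, {2,3}, {2,5}, or {2,11} (i.e. the radical of |c| is 2, 6, 10, or 22). Then (b,c) is one of (3,-2), (5,-6), (7,-12), (17,-72), (9,-20). -/
/-- If the primes dividing `m (m + 1)` are `2` and the odd prime `p`, then one of `m` and
`m + 1` is a power of `2` and the other a power of `p`. -/
theorem consecutive_eq_two_pow_and_prime_pow {m p : ℕ} (hm : m ≠ 0) (hp : p.Prime) (hp2 : p ≠ 2)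
    (h : ∀ q : ℕ, q.Prime → (q ∣ m * (m + 1) ↔ q = 2 ∨ q = p)) :
    ∃ a e : ℕ, (m = 2 ^ a ∧ m + 1 = p ^ e) ∨ (m = p ^ e ∧ m + 1 = 2 ^ a) := by
  have hnot : ∀ q : ℕ, q.Prime → q ∣ m → ¬ q ∣ m + 1 := fun q hq h₁ h₂ =>
    hq.one_lt.ne' (Nat.dvd_one.1 ((Nat.dvd_add_right h₁).1 h₂))
  have hl : ∀ q : ℕ, q.Prime → q ∣ m → q = 2 ∨ q = p := fun q hq hd =>
    (h q hq).1 (hd.mul_right _)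
  have hr : ∀ q : ℕ, q.Prime → q ∣ m + 1 → q = 2 ∨ q = p := fun q hq hd =>
    (h q hq).1 (hd.mul_left _)
  have hpow : ∀ {n r : ℕ}, n ≠ 0 → (∀ q : ℕ, q.Prime → q ∣ n → q = r) → ∃ a, n = r ^ a :=
    fun hn hq => ⟨_, Nat.eq_prime_pow_of_unique_prime_dvd hn fun {d} hd hdn => hq d hd hdn⟩
  have key : ∀ {x y : ℕ}, x ≠ 0 → y ≠ 0 → ¬ 2 ∣ y → ¬ p ∣ x →
      (∀ q : ℕ, q.Prime → q ∣ x → q = 2 ∨ q = p) → (∀ q : ℕ, q.Prime → q ∣ y → q = 2 ∨ q = p) →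
      ∃ a e : ℕ, x = 2 ^ a ∧ y = p ^ e := by
    intro x y hx hy h2y hpx hqx hqy
    obtain ⟨a, ha⟩ := hpow (r := 2) hx fun q hq hd =>
      (hqx q hq hd).resolve_right fun e => hpx (e ▸ hd)
    obtain ⟨e, he⟩ := hpow (r := p) hy fun q hq hd =>
      (hqy q hq hd).resolve_left fun e => h2y (e ▸ hd)
    exact ⟨a, e, ha, he⟩
  by_cases h2 : 2 ∣ m
  · have h2' := hnot 2 Nat.prime_two h2
    have hpm' : ¬ p ∣ m := fun hd => by
      have h1 : m + 1 = 1 := Nat.eq_one_iff_not_exists_prime_dvd.2 fun q hq hqd => by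
        rcases hr q hq hqd with rfl | rfl
        exacts [h2' hqd, hnot _ hq hd hqd]
      omega
    obtain ⟨a, e, ha, he⟩ := key hm m.succ_ne_zero h2' hpm' hl hr
    exact ⟨a, e, Or.inl ⟨ha, he⟩⟩
  · have hpm' : ¬ p ∣ m + 1 := fun hd => by
      have h1 : m = 1 := Nat.eq_one_iff_not_exists_prime_dvd.2 fun q hq hqd => by
        rcases hl q hq hqd with rfl | rfl
        exacts [h2 hqd, hnot _ hq hqd hd]
      subst h1
      exact hp2 ((Nat.prime_dvd_prime_iff_eq hp Nat.prime_two).1 hd)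
    obtain ⟨a, e, ha, he⟩ := key m.succ_ne_zero hm h2 hpm' hr hl
    exact ⟨a, e, Or.inr ⟨he, ha⟩⟩

theorem not_odd_prime_dvd_two_pow {p : ℕ} (hp : p.Prime) (hp2 : p ≠ 2) (a : ℕ) : ¬ p ∣ 2 ^ a :=
  fun h => hp2 ((Nat.prime_dvd_prime_iff_eq hp Nat.prime_two).1 (hp.dvd_of_dvd_pow h))

theorem three_pow_mod_eighty (e : ℕ) :
    3 ^ e % 80 = 1 ∨ 3 ^ e % 80 = 3 ∨ 3 ^ e % 80 = 9 ∨ 3 ^ e % 80 = 27 := by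
  induction e with
  | zero => simp
  | succ e ih => rw [pow_succ]; omega

theorem five_pow_mod_twenty_four (e : ℕ) : 5 ^ e % 24 = 1 ∨ 5 ^ e % 24 = 5 := by
  induction e with
  | zero => simp
  | succ e ih => rw [pow_succ]; omega

theorem eleven_pow_mod_one_hundred_twenty (e : ℕ) : 11 ^ e % 120 = 1 ∨ 11 ^ e % 120 = 11 := by
  induction e with
  | zero => simp
  | succ e ih => rw [pow_succ]; omega

/-- A power of two is `1`, `2`, `4`, `8` or a multiple of `16`. -/
theorem two_pow_small_or_sixteen_dvd (a : ℕ) :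
    2 ^ a = 1 ∨ 2 ^ a = 2 ∨ 2 ^ a = 4 ∨ 2 ^ a = 8 ∨ 16 ∣ 2 ^ a := by
  induction a with
  | zero => simp
  | succ a ih => rw [pow_succ]; omega

/-- The values of `m ≥ 2` for which `m (m + 1)` has radical `6`. -/
theorem consecutive_two_three_pow {m : ℕ} (hm : 2 ≤ m)
    (h : ∃ a e : ℕ, (m = 2 ^ a ∧ m + 1 = 3 ^ e) ∨ (m = 3 ^ e ∧ m + 1 = 2 ^ a)) :
    m = 2 ∨ m = 3 ∨ m = 8 := by
  obtain ⟨a, e, h⟩ := h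
  have h₁ := three_pow_mod_eighty e
  have h₂ := two_pow_small_or_sixteen_dvd a
  have h₃ := not_odd_prime_dvd_two_pow Nat.prime_five (by norm_num) a
  omega

/-- The values of `m ≥ 2` for which `m (m + 1)` has radical `10`. -/
theorem consecutive_two_five_pow {m : ℕ} (hm : 2 ≤ m)
    (h : ∃ a e : ℕ, (m = 2 ^ a ∧ m + 1 = 5 ^ e) ∨ (m = 5 ^ e ∧ m + 1 = 2 ^ a)) :
    m = 4 := by
  obtain ⟨a, e, h⟩ := h
  have h₁ := five_pow_mod_twenty_four e
  have h₂ := two_pow_small_or_sixteen_dvd a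
  have h₃ := not_odd_prime_dvd_two_pow Nat.prime_three (by norm_num) a
  omega

/-- No `m ≥ 2` is such that `m (m + 1)` has radical `22`. -/
theorem not_consecutive_two_eleven_pow {m : ℕ} (hm : 2 ≤ m) :
    ¬ ∃ a e : ℕ, (m = 2 ^ a ∧ m + 1 = 11 ^ e) ∨ (m = 11 ^ e ∧ m + 1 = 2 ^ a) := by
  rintro ⟨a, e, h⟩
  have h₁ := eleven_pow_mod_one_hundred_twenty e
  have h₂ := two_pow_small_or_sixteen_dvd a
  have h₃ := not_odd_prime_dvd_two_pow Nat.prime_five (by norm_num) a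
  omega


/-- If `b ≥ 1` and `c ≠ 0` with `b² + 4c = 1`, and the set of primes dividing `c` is one
of `{2}`, `{2,3}`, `{2,5}`, `{2,11}` (i.e. the radical of `|c|` is `2`, `6`, `10`, or
`22`), then `(b, c)` is one of `(3,-2)`, `(5,-6)`, `(7,-12)`, `(17,-72)`, `(9,-20)`. -/
theorem lucas_sequences_with_small_radical (b c : ℤ) (hb : 1 ≤ b) (hc : c ≠ 0)
    (h1 : b ^ 2 + 4 * c = 1)
    (hrad : {q : ℕ | q.Prime ∧ (q : ℤ) ∣ c} = ({2} : Set ℕ) ∨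
      {q : ℕ | q.Prime ∧ (q : ℤ) ∣ c} = ({2, 3} : Set ℕ) ∨
      {q : ℕ | q.Prime ∧ (q : ℤ) ∣ c} = ({2, 5} : Set ℕ) ∨
      {q : ℕ | q.Prime ∧ (q : ℤ) ∣ c} = ({2, 11} : Set ℕ)) :
    (b, c) = (3, -2) ∨ (b, c) = (5, -6) ∨ (b, c) = (7, -12) ∨
      (b, c) = (17, -72) ∨ (b, c) = (9, -20) := by
  obtain ⟨k, hk⟩ : ∃ k, b = 2 * k + 1 := by
    have : Odd (b ^ 2) := ⟨-(2 * c), by linarith⟩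
    exact (Int.odd_pow' two_ne_zero).1 this
  obtain ⟨m, rfl⟩ := Int.eq_ofNat_of_zero_le (show 0 ≤ k by omega)
  obtain rfl : c = -((m * (m + 1) : ℕ) : ℤ) := by
    subst hk
    push_cast
    linarith
  have hm : m ≠ 0 := by
    rintro rfl
    simp at hc
  have hdvd : ∀ {S : Set ℕ}, {q : ℕ | q.Prime ∧ (q : ℤ) ∣ -((m * (m + 1) : ℕ) : ℤ)} = S →
      ∀ q : ℕ, q.Prime → (q ∣ m * (m + 1) ↔ q ∈ S) := by
    rintro S rfl q hq
    rw [Set.mem_ofPred_eq, dvd_neg, Int.natCast_dvd_natCast]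
    exact (and_iff_right hq).symm
  have hm2 : ∀ {p : ℕ}, p.Prime → p ≠ 2 →
      (∀ q : ℕ, q.Prime → (q ∣ m * (m + 1) ↔ q = 2 ∨ q = p)) → 2 ≤ m := by
    intro p hp hp2 h
    by_contra hlt
    obtain rfl : m = 1 := by omega
    exact hp2 ((Nat.prime_dvd_prime_iff_eq hp Nat.prime_two).1 ((h p hp).2 (Or.inr rfl)))
  have hcase : m = 1 ∨ m = 2 ∨ m = 3 ∨ m = 8 ∨ m = 4 := by
    rcases hrad with h | h | h | h
    · left
      have h := hdvd h
      rw [Nat.eq_one_iff_not_exists_prime_dvd]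
      intro q hq hqm
      obtain rfl : q = 2 := (h q hq).1 (hqm.mul_right _)
      have h1 : m + 1 = 1 := Nat.eq_one_iff_not_exists_prime_dvd.2 fun r hr hrm => by
        obtain rfl : r = 2 := (h r hr).1 (hrm.mul_left _)
        omega
      omega
    · have h := hdvd h
      have := consecutive_two_three_pow (hm2 Nat.prime_three (by norm_num) h)
        (consecutive_eq_two_pow_and_prime_pow hm Nat.prime_three (by norm_num) h)
      tauto
    · have h := hdvd h
      have := consecutive_two_five_pow (hm2 Nat.prime_five (by norm_num) h)
        (consecutive_eq_two_pow_and_prime_pow hm Nat.prime_five (by norm_num) h)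
      tauto
    · have h := hdvd h
      have h11 : Nat.Prime 11 := by norm_num
      exact absurd (consecutive_eq_two_pow_and_prime_pow hm h11 (by norm_num) h)
        (not_consecutive_two_eleven_pow (hm2 h11 (by norm_num) h))
  subst hk
  rcases hcase with rfl | rfl | rfl | rfl | rfl <;> norm_num
end

section
/- The only rational point (x, y) ∈ ℚ × ℚ on the affine curve y^2 = x^3 + 22x^2 + 125x is (0, 0). Equivalently, the elliptic curve X : y^2 = x^3 + 22x^2 + 125x over ℚ has exactly two rational points: (0,0) and the point at infinity. -/
/-- Coprime positive factors of a fourth power are fourth powers. -/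
theorem exists_pow_four_of_mul_eq {x y N : ℤ} (hx : 0 < x) (hy : 0 < y) (hN : 0 < N)
    (hxy : IsCoprime x y) (h : x * y = N ^ 4) :
    ∃ a b : ℤ, 0 < a ∧ 0 < b ∧ x = a ^ 4 ∧ y = b ^ 4 ∧ N = a * b := by
  lift x to ℕ using hx.le
  lift y to ℕ using hy.le
  lift N to ℕ using hN.le
  rw [Nat.isCoprime_iff_coprime] at hxy
  norm_cast at h
  obtain ⟨a, rfl⟩ := exists_eq_pow_of_mul_eq_pow (Nat.isUnit_iff.2 hxy) h
  obtain ⟨b, rfl⟩ := exists_eq_pow_of_mul_eq_pow (Nat.isUnit_iff.2 hxy.symm)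
    ((mul_comm _ _).trans h)
  have hab : a * b = N := by
    rw [← mul_pow] at h
    exact Nat.pow_left_injective (by norm_num : (4 : ℕ) ≠ 0) h
  refine ⟨a, b, ?_, ?_, by push_cast; rfl, by push_cast; rfl, by exact_mod_cast hab.symm⟩
  · rcases Nat.eq_zero_or_pos a with rfl | ha
    · simp at hx
    · exact_mod_cast ha
  · rcases Nat.eq_zero_or_pos b with rfl | hb
    · simp at hy
    · exact_mod_cast hb

theorem exists_add_eq_of_mul_eq {x y N : ℤ} (hx : 0 < x) (hy : 0 < y) (hN : 0 < N)
    (hxy : IsCoprime x y) (h : x * y = 125 * N ^ 4) :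
    ∃ a b : ℤ, 0 < a ∧ 0 < b ∧ IsCoprime a b ∧ N = a * b ∧ x + y = a ^ 4 + 125 * b ^ 4 := by
  have h5 : Prime (5 : ℤ) := by norm_num
  wlog hdvd : (5 : ℤ) ∣ y generalizing x y
  · have hdvd' : (5 : ℤ) ∣ x :=
      (h5.dvd_or_dvd (h ▸ ⟨25 * N ^ 4, by ring⟩)).resolve_right hdvd
    simpa only [add_comm y x] using this hy hx hxy.symm ((mul_comm _ _).trans h) hdvd'
  have hx5 : IsCoprime (125 : ℤ) x := by
    have : IsCoprime (5 : ℤ) x := (hxy.of_isCoprime_of_dvd_right hdvd).symm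
    simpa using this.pow_left (m := 3)
  obtain ⟨z, rfl⟩ : (125 : ℤ) ∣ y := hx5.dvd_of_dvd_mul_left (Dvd.intro _ h.symm)
  obtain ⟨a, b, ha, hb, rfl, rfl, rfl⟩ := exists_pow_four_of_mul_eq hx (y := z) (by lia) hN
    hxy.of_mul_right_right (by linarith)
  refine ⟨a, b, ha, hb, ?_, rfl, rfl⟩
  exact (IsCoprime.pow_iff (by norm_num) (by norm_num)).1 hxy.of_mul_right_right

theorem five_dvd_of_dvd_sq_sub {m n : ℤ} (h : (5 : ℤ) ∣ m ^ 2 - 2 * n ^ 2) :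
    (5 : ℤ) ∣ m ∧ (5 : ℤ) ∣ n := by
  have key : ∀ u v : ZMod 5, u ^ 2 - 2 * v ^ 2 = 0 → u = 0 ∧ v = 0 := by decide
  have h' := (ZMod.intCast_zmod_eq_zero_iff_dvd _ 5).2 h
  push_cast at h'
  obtain ⟨hu, hv⟩ := key _ _ h'
  exact ⟨(ZMod.intCast_zmod_eq_zero_iff_dvd _ 5).1 hu,
    (ZMod.intCast_zmod_eq_zero_iff_dvd _ 5).1 hv⟩

theorem isCoprime_of_forall_prime {x y : ℤ} (hx : x ≠ 0)
    (h : ∀ p : ℤ, Prime p → p ∣ x → ¬ p ∣ y) : IsCoprime x y :=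
  isCoprime_of_prime_dvd (fun h0 => hx h0.1) h

/-- The descent step: a primitive solution of `s² = m⁴ - 11m²n² - n⁴` gives a primitive point on
`t² = a⁴ + 22a²b² + 125b⁴` with `0 < b ≤ n`. -/
theorem exists_isSquare_quartic_of_sq_eq {m n s : ℤ} (hn : 0 < n) (hmn : IsCoprime m n)
    (h : s ^ 2 = m ^ 4 - 11 * m ^ 2 * n ^ 2 - n ^ 4) :
    ∃ a b : ℤ, 0 < b ∧ b ≤ n ∧ IsCoprime a b ∧
      IsSquare (a ^ 4 + 22 * a ^ 2 * b ^ 2 + 125 * b ^ 4) := by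
  have hlt : 11 * n ^ 2 < m ^ 2 := by
    by_contra! hle
    have : 0 < n ^ 4 := by positivity
    nlinarith [sq_nonneg s, mul_le_mul_of_nonneg_left hle (sq_nonneg m)]
  have hn2 : 0 < n ^ 2 := by positivity
  have h5 : ∀ p : ℤ, Prime p → p ∣ 125 → (5 : ℤ) ∣ p := fun p hp hd => by
    have hd' : p ∣ 5 := hp.dvd_of_dvd_pow (n := 3) (by simpa using hd)
    exact (hp.associated_of_dvd (by norm_num) hd').symm.dvd
  rcases Int.even_or_odd' n with ⟨N, rfl | hodd⟩
  · have hN : 0 < N := by lia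
    have hmN : IsCoprime m N := hmn.of_mul_right_right
    have hm : ¬ (2 : ℤ) ∣ m := fun hd =>
      (by norm_num : Prime (2 : ℤ)).not_isUnit (hmn.isUnit_of_dvd' hd (Dvd.intro _ rfl))
    have hm' : Odd m := by simpa [← even_iff_two_dvd] using hm
    have hs' : Odd s := by
      have : Odd (s ^ 2) := by
        rw [h, show m ^ 4 - 11 * m ^ 2 * (2 * N) ^ 2 - (2 * N) ^ 4
          = m ^ 4 - 2 * (22 * m ^ 2 * N ^ 2 + 8 * N ^ 4) by ring]
        exact hm'.pow.sub_even (even_two_mul _)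
      exact (Int.odd_pow.1 this).resolve_right (by norm_num)
    obtain ⟨c, hc⟩ := (hm'.pow (n := 2)).sub_odd hs'
    obtain ⟨x, hx⟩ : ∃ x, x = c - 11 * N ^ 2 + s := ⟨_, rfl⟩
    obtain ⟨y, hy⟩ : ∃ y, y = c - 11 * N ^ 2 := ⟨_, rfl⟩
    have hsum : x + y = m ^ 2 - 22 * N ^ 2 := by rw [hx, hy]; linarith
    have hdiff : x - y = s := by rw [hx, hy]; ring
    have hprod : x * y = 125 * N ^ 4 := by
      have : (x + y) ^ 2 - (x - y) ^ 2 = 500 * N ^ 4 := by rw [hsum, hdiff, h]; ring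
      linarith [this, show (x + y) ^ 2 - (x - y) ^ 2 = 4 * (x * y) by ring]
    have hpos : 0 < x * y := by rw [hprod]; positivity
    have hspos : 0 < x + y := by rw [hsum]; nlinarith
    obtain ⟨hx0, hy0⟩ : 0 < x ∧ 0 < y := by
      rcases mul_pos_iff.1 hpos with h | h
      · exact h
      · lia
    have hcop : IsCoprime x y := by
      refine isCoprime_of_forall_prime hx0.ne' fun p hp hpx hpy => ?_
      have hps : p ∣ m ^ 2 - 22 * N ^ 2 := hsum ▸ dvd_add hpx hpy
      rcases hp.dvd_or_dvd (hprod ▸ hpx.mul_right y) with hd | hd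
      · have := five_dvd_of_dvd_sq_sub (m := m) (n := N) (by
          have := ((h5 p hp hd).trans hps).add (Dvd.intro (4 * N ^ 2) (a := (5 : ℤ)) rfl)
          ring_nf at this ⊢; exact this)
        exact (by norm_num : Prime (5 : ℤ)).not_isUnit (hmN.isUnit_of_dvd' this.1 this.2)
      · have hpN := hp.dvd_of_dvd_pow hd
        have : p ∣ m ^ 2 := by
          have := hps.add ((dvd_pow hpN two_ne_zero).mul_left 22)
          simpa using this
        exact hp.not_isUnit (hmN.isUnit_of_dvd' (hp.dvd_of_dvd_pow this) hpN)
    obtain ⟨a, b, ha, hb, hab, rfl, hadd⟩ := exists_add_eq_of_mul_eq hx0 hy0 hN hcop hprod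
    exact ⟨a, b, hb, by nlinarith, hab, m, by linarith⟩
  · have hn' : Odd n := ⟨N, hodd⟩
    obtain ⟨x, hx⟩ : ∃ x, x = 2 * m ^ 2 - 11 * n ^ 2 + 2 * s := ⟨_, rfl⟩
    obtain ⟨y, hy⟩ : ∃ y, y = 2 * m ^ 2 - 11 * n ^ 2 - 2 * s := ⟨_, rfl⟩
    have hsum : x + y = 2 * (2 * m ^ 2 - 11 * n ^ 2) := by rw [hx, hy]; ring
    have hprod : x * y = 125 * n ^ 4 := by
      rw [hx, hy]; linear_combination (-4) * h
    have hpos : 0 < x * y := by rw [hprod]; positivity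
    obtain ⟨hx0, hy0⟩ : 0 < x ∧ 0 < y := by
      rcases mul_pos_iff.1 hpos with h | h
      · exact h
      · lia
    have hcop : IsCoprime x y := by
      refine isCoprime_of_forall_prime hx0.ne' fun p hp hpx hpy => ?_
      have hp2 : ¬ p ∣ 2 := fun hd => by
        have h2 : (2 : ℤ) ∣ p := (hp.associated_of_dvd (by norm_num) hd).symm.dvd
        have : Even (125 * n ^ 4) := even_iff_two_dvd.2 (h2.trans (hprod ▸ hpx.mul_right y))
        exact Int.not_even_iff_odd.2 ((by decide : Odd (125 : ℤ)).mul hn'.pow) this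
      have hps : p ∣ 2 * m ^ 2 - 11 * n ^ 2 :=
        (hp.dvd_or_dvd (hsum ▸ dvd_add hpx hpy)).resolve_left hp2
      rcases hp.dvd_or_dvd (hprod ▸ hpx.mul_right y) with hd | hd
      · have := five_dvd_of_dvd_sq_sub (m := n) (n := m) (by
          have := ((h5 p hp hd).trans hps).add (Dvd.intro (2 * n ^ 2) (a := (5 : ℤ)) rfl)
          rw [← dvd_neg]
          ring_nf at this ⊢; exact this)
        exact (by norm_num : Prime (5 : ℤ)).not_isUnit (hmn.isUnit_of_dvd' this.2 this.1)
      · have hpn := hp.dvd_of_dvd_pow hd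
        have : p ∣ 2 * m ^ 2 := by
          have := hps.add ((dvd_pow hpn two_ne_zero).mul_left 11)
          simpa using this
        exact hp.not_isUnit (hmn.isUnit_of_dvd'
          (hp.dvd_of_dvd_pow ((hp.dvd_or_dvd this).resolve_left hp2)) hpn)
    obtain ⟨a, b, ha, hb, hab, rfl, hadd⟩ := exists_add_eq_of_mul_eq hx0 hy0 hn hcop hprod
    exact ⟨a, b, hb, by nlinarith, hab, 2 * m, by linarith⟩

theorem not_isSquare_int_quartic (B : ℕ) (hB : 0 < B) (s : ℤ) (hs : IsCoprime s B) :
    ¬ IsSquare (s ^ 4 + 22 * s ^ 2 * (B : ℤ) ^ 2 + 125 * (B : ℤ) ^ 4) := by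
  induction B using Nat.strong_induction_on generalizing s with
  | _ B ih =>
  intro hsq
  obtain ⟨t, ht0, ht⟩ : ∃ t : ℤ, 0 ≤ t ∧
      t ^ 2 = s ^ 4 + 22 * s ^ 2 * (B : ℤ) ^ 2 + 125 * (B : ℤ) ^ 4 := by
    obtain ⟨t, ht⟩ := hsq
    exact ⟨|t|, abs_nonneg t, by rw [sq_abs, ht]; ring⟩
  have hBpos : (0 : ℤ) < B := by exact_mod_cast hB
  obtain ⟨p, hp⟩ : ∃ p, t + s ^ 2 + 11 * (B : ℤ) ^ 2 = 2 * p := by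
    have : Even ((t + s ^ 2 + 11 * (B : ℤ) ^ 2) ^ 2) := by
      rw [show (t + s ^ 2 + 11 * (B : ℤ) ^ 2) ^ 2 =
        2 * (t * (t + s ^ 2 + 11 * (B : ℤ) ^ 2) - 2 * (B : ℤ) ^ 4) by
          linear_combination -ht]
      exact even_two_mul _
    exact even_iff_two_dvd.1 (Int.even_pow.1 this).1
  obtain ⟨q, hq⟩ : ∃ q, q = p - (s ^ 2 + 11 * (B : ℤ) ^ 2) := ⟨_, rfl⟩
  have hpq : p * q = (B : ℤ) ^ 4 := by
    have : p + q = t := by rw [hq]; linarith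
    have h2 : (p + q) ^ 2 - (p - q) ^ 2 = 4 * (B : ℤ) ^ 4 := by
      rw [this, ht, hq]; ring
    linarith [show (p + q) ^ 2 - (p - q) ^ 2 = 4 * (p * q) by ring]
  have hp0 : 0 < p := by nlinarith [sq_nonneg s, pow_pos hBpos 2]
  have hq0 : 0 < q := pos_of_mul_pos_right (by rw [hpq]; positivity) hp0.le
  have hcop : IsCoprime p q := by
    refine isCoprime_of_forall_prime hp0.ne' fun r hr hrp hrq => ?_
    have hrB : r ∣ (B : ℤ) := hr.dvd_of_dvd_pow (hpq ▸ hrp.mul_right q)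
    have : r ∣ s ^ 2 := by
      have := (hrp.sub hrq).sub ((dvd_pow hrB two_ne_zero).mul_left 11)
      rw [hq] at this
      simpa using this
    exact hr.not_isUnit (hs.isUnit_of_dvd' (hr.dvd_of_dvd_pow this) hrB)
  obtain ⟨m, n, hm, hn, rfl, rfl, hmn⟩ := exists_pow_four_of_mul_eq hp0 hq0 hBpos hcop hpq
  rw [hmn] at hq
  obtain ⟨a, b, hb, hbn, hab, hab'⟩ := exists_isSquare_quartic_of_sq_eq (s := s) hn
    ((IsCoprime.pow_iff (by norm_num) (by norm_num)).1 hcop) (by linarith)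
  have hm1 : 1 < m := by
    by_contra! hle
    obtain rfl : m = 1 := by lia
    nlinarith [sq_nonneg s, pow_pos hn 2, pow_pos hn 4]
  lift b to ℕ using hb.le
  refine ih b ?_ (by exact_mod_cast hb) a hab hab'
  have : (b : ℤ) < B := by rw [hmn]; nlinarith
  exact_mod_cast this

theorem not_isSquare_rat_quartic (w : ℚ) : ¬ IsSquare (w ^ 4 + 22 * w ^ 2 + 125) := by
  intro h
  refine not_isSquare_int_quartic w.den w.den_pos w.num ?_ ?_
  · exact Int.isCoprime_iff_gcd_eq_one.2 w.reduced
  · rw [← Rat.isSquare_intCast_iff]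
    have hw : (w.num : ℚ) = w * w.den := (Rat.mul_den_eq_num w).symm
    push_cast
    rw [hw]
    rw [show (w * w.den) ^ 4 + 22 * (w * w.den) ^ 2 * (w.den : ℚ) ^ 2 + 125 * (w.den : ℚ) ^ 4
      = (w ^ 4 + 22 * w ^ 2 + 125) * ((w.den : ℚ) ^ 2) ^ 2 by ring]
    exact h.mul (IsSquare.sq _)

theorem exists_sq_or_five_mul_sq {x y : ℚ} (hx : 0 < x)
    (h : y ^ 2 = x ^ 3 + 22 * x ^ 2 + 125 * x) : ∃ u : ℚ, x = u ^ 2 ∨ x = 5 * u ^ 2 := by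
  obtain ⟨A, D, hA, hD, hAD, rfl⟩ :
      ∃ A D : ℕ, 0 < A ∧ 0 < D ∧ A.Coprime D ∧ x = A / D := by
    have hnum : 0 < x.num := Rat.num_pos.2 hx
    refine ⟨x.num.natAbs, x.den, Int.natAbs_pos.2 hnum.ne', x.den_pos, x.reduced, ?_⟩
    rw [Nat.cast_natAbs, abs_of_pos hnum, Rat.num_div_den]
  have hDq : (D : ℚ) ≠ 0 := by exact_mod_cast hD.ne'
  obtain ⟨c, r, hcr, hc⟩ := Nat.sq_mul_squarefree (A * D)
  have hr : r ≠ 0 := by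
    rintro rfl
    have := Nat.mul_pos hA hD
    simp at hcr
    lia
  have hrq : (r : ℚ) ≠ 0 := by exact_mod_cast hr
  have hcrq : (r : ℚ) ^ 2 * c = A * D := by exact_mod_cast hcr
  obtain ⟨k, hk⟩ : IsSquare (c * (A ^ 2 + 22 * A * D + 125 * D ^ 2)) := by
    rw [← Rat.isSquare_natCast_iff]
    refine ⟨y * D ^ 2 / r, ?_⟩
    field_simp at h ⊢
    push_cast
    linear_combination (A ^ 2 + 22 * A * D + 125 * D ^ 2 : ℚ) * hcrq - D * h
  have hck : c ∣ A ^ 2 + 22 * A * D + 125 * D ^ 2 := by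
    have hck : c ∣ k := (hc.dvd_pow_iff_dvd two_ne_zero).1 ⟨_, (sq k).trans hk.symm⟩
    have : c * c ∣ c * (A ^ 2 + 22 * A * D + 125 * D ^ 2) := hk ▸ mul_dvd_mul hck hck
    exact Nat.dvd_of_mul_dvd_mul_left (Nat.pos_of_ne_zero hc.ne_zero) this
  have hc5 : c ∣ 5 := by
    have hcD : c.Coprime D := Nat.coprime_of_dvd fun p hp hpc hpD => by
      have hpA : p ∣ A ^ 2 := by
        have := hpc.trans hck
        rw [add_assoc, Nat.dvd_add_left ((hpD.mul_left _).add
          ((dvd_pow hpD two_ne_zero).mul_left _))] at this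
        exact this
      exact Nat.not_coprime_of_dvd_of_dvd hp.one_lt (hp.dvd_of_dvd_pow hpA) hpD hAD
    have hcA : c ∣ A := hcD.dvd_of_dvd_mul_right (Dvd.intro_left _ hcr)
    rw [Nat.dvd_add_right ((dvd_pow hcA two_ne_zero).add ((hcA.mul_left _).mul_right _))] at hck
    have : c ∣ 5 ^ 3 := (hcD.pow_right 2).dvd_of_dvd_mul_right hck
    exact (hc.dvd_pow_iff_dvd three_ne_zero).1 this
  have hx' : (A / D : ℚ) = c * (r / D) ^ 2 := by
    field_simp
    linear_combination -hcrq
  refine ⟨r / D, ?_⟩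
  rcases (Nat.dvd_prime (by norm_num)).1 hc5 with rfl | rfl
  · left; simpa using hx'
  · right; simpa using hx'

/-- The only rational point `(x, y)` on the affine curve `y² = x³ + 22x² + 125x`
is `(0, 0)`. -/
theorem rational_points_of_curve (x y : ℚ) :
    y ^ 2 = x ^ 3 + 22 * x ^ 2 + 125 * x ↔ x = 0 ∧ y = 0 := by
  refine ⟨fun h => ?_, by rintro ⟨rfl, rfl⟩; norm_num⟩
  rcases eq_or_ne x 0 with rfl | hx
  · simpa using h
  have hpos : 0 < x := by
    by_contra! hle
    have hlt := lt_of_le_of_ne hle hx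
    nlinarith [sq_nonneg y, mul_pos_of_neg_of_neg hlt hlt,
      mul_nonneg (neg_nonneg.2 hle) (sq_nonneg (x + 11))]
  obtain ⟨u, rfl | rfl⟩ := exists_sq_or_five_mul_sq hpos h
  · have hu : u ≠ 0 := by rintro rfl; simp at hx
    refine (not_isSquare_rat_quartic u ⟨y / u, ?_⟩).elim
    field_simp
    linear_combination -h
  · have hu : u ≠ 0 := by rintro rfl; simp at hx
    refine (not_isSquare_rat_quartic (5 / u) ⟨y / u ^ 3, ?_⟩).elim
    field_simp
    linear_combination -h
end
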